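/- Assume ε > 1/2, η satisfies (H₀)–(H₄) and V satisfies (H'₀)–(H'₃) (all with this ε), and let a ≤ b be real numbers such that [a,b] contains none of −1/2, −1/3, 1 and contains no eigenvalue of H̃ := Δ̃ + V(Q). Then there exists a continuous map r from [a,b] to the bounded operators on ℓ²(ℤ²,ℂ) (with the operator-norm topology) such that for every λ ∈ [a,b], Λ^{−ε}(Q) ∘ (H̃ − (λ + iρ))⁻¹ ∘ Λ^{−ε}(Q) converges in operator norm to r(λ) as ρ → 0⁺; i.e., the boundary values of the weighted resolvent exist and depend continuously on λ. -/

import Mathlib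

open scoped ENNReal
open Filter

noncomputable section

/-- The Hilbert space `ℓ²(ℤ², ℂ)`. -/
abbrev H2 : Type := lp (fun _ : ℤ × ℤ => ℂ) 2

/-- The triangular-lattice Laplacian, acting pointwise on functions `ℤ² → ℂ`. -/
def lapT (f : ℤ × ℤ → ℂ) : ℤ × ℤ → ℂ := fun n =>
  (1/6 : ℂ) * (f (n.1 + 1, n.2) + f (n.1 - 1, n.2) + f (n.1, n.2 + 1)
    + f (n.1, n.2 - 1) + f (n.1 + 1, n.2 - 1) + f (n.1 - 1, n.2 + 1))

/-- The symbol `F(x₁,x₂) = (1/3)(cos x₁ + cos x₂ + cos (x₁ - x₂))`. -/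
def symbF (x : ℝ × ℝ) : ℝ := (1/3) * (Real.cos x.1 + Real.cos x.2 + Real.cos (x.1 - x.2))

/-- `∂₁ F`. -/
def d1F (x : ℝ × ℝ) : ℝ := -(1/3) * (Real.sin x.1 + Real.sin (x.1 - x.2))

/-- `∂₂ F`. -/
def d2F (x : ℝ × ℝ) : ℝ := -(1/3) * (Real.sin x.2 - Real.sin (x.1 - x.2))

/-- Japanese bracket `⟨t⟩ = √(1/2 + t²)`. -/
def jap (t : ℝ) : ℝ := Real.sqrt (1/2 + t^2)

/-- The weight `Λ(n₁,n₂) = ⟨n₁⟩ + ⟨n₂⟩`. -/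
def Lam (n : ℤ × ℤ) : ℝ := jap (n.1 : ℝ) + jap (n.2 : ℝ)

/-- The conjugate operator `A`, acting pointwise on functions `ℤ² → ℂ`. -/
def opA (f : ℤ × ℤ → ℂ) : ℤ × ℤ → ℂ := fun n =>
  (Complex.I / 6) *
    (((n.1 : ℂ) + 1/2) * f (n.1 + 1, n.2) - ((n.1 : ℂ) - 1/2) * f (n.1 - 1, n.2)
      + ((n.2 : ℂ) + 1/2) * f (n.1, n.2 + 1) - ((n.2 : ℂ) - 1/2) * f (n.1, n.2 - 1)
      + ((n.2 : ℂ) - (n.1 : ℂ) + 1) * f (n.1 - 1, n.2 + 1)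
      + ((n.1 : ℂ) - (n.2 : ℂ) + 1) * f (n.1 + 1, n.2 - 1))

/-- The perturbed Laplacian `Δ̃` with weight `m`, acting pointwise on functions `ℤ² → ℂ`:
`(Δ̃ f)(n) = (1/6) Σ_{l ∼ n} f(l) / (√(m n) √(m l))`. -/
def lapPert (m : ℤ × ℤ → ℝ) (f : ℤ × ℤ → ℂ) : ℤ × ℤ → ℂ := fun n =>
  (1/6 : ℂ) *
    (f (n.1 + 1, n.2) / ((Real.sqrt (m n) * Real.sqrt (m (n.1 + 1, n.2)) : ℝ) : ℂ)
      + f (n.1 - 1, n.2) / ((Real.sqrt (m n) * Real.sqrt (m (n.1 - 1, n.2)) : ℝ) : ℂ)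
      + f (n.1, n.2 + 1) / ((Real.sqrt (m n) * Real.sqrt (m (n.1, n.2 + 1)) : ℝ) : ℂ)
      + f (n.1, n.2 - 1) / ((Real.sqrt (m n) * Real.sqrt (m (n.1, n.2 - 1)) : ℝ) : ℂ)
      + f (n.1 + 1, n.2 - 1) / ((Real.sqrt (m n) * Real.sqrt (m (n.1 + 1, n.2 - 1)) : ℝ) : ℂ)
      + f (n.1 - 1, n.2 + 1) / ((Real.sqrt (m n) * Real.sqrt (m (n.1 - 1, n.2 + 1)) : ℝ) : ℂ))

section CoerciveOperators

variable {E : Type*} [NormedAddCommGroup E] [InnerProductSpace ℂ E] [CompleteSpace E]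

/-- The operator `S` is bounded below by `m > 0` in the sense of its quadratic form. -/
def FormCoercive (S : E →L[ℂ] E) (m : ℝ) : Prop :=
  0 < m ∧ ∀ u : E, m * ‖u‖ ^ 2 ≤ ‖inner ℂ u (S u)‖

namespace FormCoercive

variable {S : E →L[ℂ] E} {m : ℝ}

theorem isUnit (h : FormCoercive S m) : IsUnit S := by
  refine ContinuousLinearMap.isUnit_of_forall_le_norm_inner_map S (c := ⟨m, h.1.le⟩) h.1 fun u => ?_
  rw [norm_inner_symm, mul_comm]
  exact h.2 u

theorem star (h : FormCoercive S m) : FormCoercive (star S) m := by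
  refine ⟨h.1, fun u => ?_⟩
  rw [ContinuousLinearMap.star_eq_adjoint, ContinuousLinearMap.adjoint_inner_right,
    norm_inner_symm]
  exact h.2 u

theorem mul_inverse (h : FormCoercive S m) : S * Ring.inverse S = 1 :=
  Ring.mul_inverse_cancel _ h.isUnit

theorem inverse_mul (h : FormCoercive S m) : Ring.inverse S * S = 1 :=
  Ring.inverse_mul_cancel _ h.isUnit

theorem sq_norm_inverse_mul_le (h : FormCoercive S m) (X : E →L[ℂ] E) :
    m * ‖Ring.inverse S * X‖ ^ 2 ≤ ‖Star.star X * Ring.inverse S * X‖ := by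
  set G := Ring.inverse S with hG
  set q := ‖Star.star X * G * X‖ with hq
  have hq0 : 0 ≤ q := norm_nonneg _
  have hm := h.1
  have key : ‖G * X‖ ≤ Real.sqrt (q / m) := by
    refine ContinuousLinearMap.opNorm_le_bound _ (Real.sqrt_nonneg _) fun f => ?_
    have h1 := h.2 (G (X f))
    have h2 : S (G (X f)) = X f := by
      have := congrArg (fun T : E →L[ℂ] E => T (X f)) h.mul_inverse
      simpa using this
    rw [h2] at h1
    have h3 : inner ℂ (G (X f)) (X f) = inner ℂ ((Star.star X * G * X) f) f := by
      simp only [mul_apply_eq_comp, ContinuousLinearMap.star_eq_adjoint,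
        ContinuousLinearMap.adjoint_inner_left]
    have h4 : m * ‖G (X f)‖ ^ 2 ≤ q * ‖f‖ ^ 2 := by
      refine h1.trans ?_
      rw [h3]
      refine (norm_inner_le_norm _ _).trans ?_
      have := (Star.star X * G * X).le_opNorm f
      nlinarith [norm_nonneg f]
    rw [mul_apply_eq_comp]
    refine abs_le_of_sq_le_sq' ?_ (by positivity) |>.2
    rw [mul_pow, Real.sq_sqrt (by positivity), div_mul_eq_mul_div, le_div_iff₀ hm]
    linarith
  have h5 : ‖G * X‖ ^ 2 ≤ q / m := by
    calc ‖G * X‖ ^ 2 ≤ Real.sqrt (q / m) ^ 2 := by gcongr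
      _ = q / m := Real.sq_sqrt (by positivity)
  rw [le_div_iff₀ hm] at h5
  linarith

theorem sq_norm_mul_inverse_le (h : FormCoercive S m) (X : E →L[ℂ] E) :
    m * ‖Star.star X * Ring.inverse S‖ ^ 2 ≤ ‖Star.star X * Ring.inverse S * X‖ := by
  have h1 := h.star.sq_norm_inverse_mul_le X
  rw [Ring.inverse_star] at h1
  have h2 : Star.star (Star.star X * Ring.inverse S) = Star.star (Ring.inverse S) * X := by simp
  have h3 : Star.star (Star.star X * Ring.inverse S * X)
      = Star.star X * Star.star (Ring.inverse S) * X := by simp [mul_assoc]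
  rwa [← h2, ← h3, norm_star, norm_star] at h1

theorem norm_inverse_le (h : FormCoercive S m) : m * ‖Ring.inverse S‖ ≤ 1 := by
  have h1 := h.sq_norm_inverse_mul_le 1
  simp only [mul_one, star_one, one_mul] at h1
  rcases (norm_nonneg (Ring.inverse S)).eq_or_lt with h0 | h0
  · rw [← h0]; simp
  · nlinarith

end FormCoercive

omit [CompleteSpace E] in
theorem norm_le_of_forall_inner_le {X : E →L[ℂ] E} {C : ℝ} (hC : 0 ≤ C)
    (h : ∀ f g : E, ‖inner ℂ f (X g)‖ ≤ C * ‖f‖ * ‖g‖) : ‖X‖ ≤ C := by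
  refine ContinuousLinearMap.opNorm_le_bound _ hC fun g => ?_
  rcases (norm_nonneg (X g)).eq_or_lt with h0 | h0
  · rw [← h0]; positivity
  · have := h (X g) g
    rw [inner_self_eq_norm_sq_to_K] at this
    simp only [norm_pow, Complex.coe_algebraMap, Complex.norm_real, norm_norm] at this
    nlinarith

end CoerciveOperators

section Mourre

/-- The data of an abstract positive commutator argument near the energy `lam₀`: a bounded
self-adjoint operator `H`, bounded approximations `A L` of a conjugate operator, whose commutators
with `H` converge to `-I (B₀ + T)`, a weight `W` with regularizations `N δ * W`, and a positivity
estimate for `B₀ + T` localized in energy. -/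
structure ConjugateData (E : Type*) [NormedAddCommGroup E] [InnerProductSpace ℂ E]
    [CompleteSpace E] where
  H : E →L[ℂ] E
  B₀ : E →L[ℂ] E
  T : E →L[ℂ] E
  T₁ : E →L[ℂ] E
  W : E →L[ℂ] E
  N : ℝ → E →L[ℂ] E
  A : ℕ → E →L[ℂ] E
  lam₀ : ℝ
  ε : ℝ
  κ : ℝ
  C₀ : ℝ
  c : ℝ
  ρ : ℝ
  half_lt_ε : 1 / 2 < ε
  ε_le_one : ε ≤ 1
  one_le_κ : 1 ≤ κ
  C₀_nonneg : 0 ≤ C₀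
  C₀_le : C₀ ≤ κ
  c_pos : 0 < c
  ρ_pos : 0 < ρ
  selfAdjoint_H : IsSelfAdjoint H
  selfAdjoint_T : IsSelfAdjoint T
  selfAdjoint_W : IsSelfAdjoint W
  selfAdjoint_N : ∀ δ, IsSelfAdjoint (N δ)
  selfAdjoint_A : ∀ L, IsSelfAdjoint (A L)
  T_eq : T = W * T₁
  norm_H_sub_le : ∀ lam : ℝ, |lam - lam₀| < ρ → ‖H - (lam : ℂ) • 1‖ ≤ κ
  norm_W_le : ‖W‖ ≤ κ
  norm_T₁_le : ‖T₁‖ ≤ κ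
  norm_B₀_le : ‖B₀‖ ≤ κ
  norm_N_le : ∀ δ, 0 < δ → ‖N δ‖ ≤ 1
  commute_N_W : ∀ δ, Commute (N δ) W
  hasDerivAt_N : ∀ δ, 0 < δ → HasDerivAt N (-(δ⁻¹ • (N δ * (1 - N δ)))) δ
  norm_one_sub_N_mul_W_le : ∀ δ, 0 < δ → ‖(1 - N δ) * W‖ ≤ κ * δ ^ ε
  norm_A_mul_N_mul_W_le : ∀ L δ, 0 < δ → ‖A L * (N δ * W)‖ ≤ κ * δ ^ (ε - 1)
  norm_commutator_H_le : ∀ L, ‖H * A L - A L * H‖ ≤ κ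
  norm_commutator_B₀_le : ∀ L, ‖B₀ * A L - A L * B₀‖ ≤ κ
  tendsto_commutator : ∀ f g : E, Filter.Tendsto
    (fun L => inner ℂ f ((H * A L - A L * H) g)) Filter.atTop
      (nhds (inner ℂ f (-(Complex.I • (B₀ + T) g))))
  positivity : ∀ lam : ℝ, |lam - lam₀| < ρ → ∀ f : E,
    c * ‖f‖ ^ 2 ≤ (inner ℂ f ((B₀ + T) f)).re + C₀ * ‖(H - (lam : ℂ) • 1) f‖ ^ 2

namespace ConjugateData

variable {E : Type*} [NormedAddCommGroup E] [InnerProductSpace ℂ E] [CompleteSpace E]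
  (D : ConjugateData E)

/-- The dissipative term of the regularized resolvent. -/
def M (δ lam : ℝ) : E →L[ℂ] E :=
  D.B₀ + D.N δ * D.T * D.N δ + (D.C₀ : ℂ) •
    ((D.H - (lam : ℂ) • 1) * (D.H - (lam : ℂ) • 1))

/-- The operator whose inverse is the regularized resolvent. -/
def S (δ : ℝ) (z : ℂ) : E →L[ℂ] E := D.H - z • 1 - (Complex.I * δ) • D.M δ z.re

/-- The regularized resolvent. -/
def G (δ : ℝ) (z : ℂ) : E →L[ℂ] E := Ring.inverse (D.S δ z)

/-- The regularized weight. -/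
def Wd (δ : ℝ) : E →L[ℂ] E := D.N δ * D.W

/-- The regularized weighted resolvent. -/
def F (δ : ℝ) (z : ℂ) : E →L[ℂ] E := D.Wd δ * D.G δ z * D.Wd δ

/-- The spectral parameters under consideration. -/
def Admissible (z : ℂ) : Prop := |z.re - D.lam₀| < D.ρ ∧ 0 < z.im ∧ z.im ≤ 1

/-- The regularization parameters under consideration. -/
def Small (δ : ℝ) : Prop := 0 < δ ∧ δ ≤ 1 ∧ 2 * D.κ ^ 2 * δ ^ D.ε ≤ D.c / 2

theorem κ_pos : 0 < D.κ := lt_of_lt_of_le one_pos D.one_le_κ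

theorem selfAdjoint_Wd (δ : ℝ) : IsSelfAdjoint (D.Wd δ) := by
  rw [IsSelfAdjoint, Wd, star_mul, D.selfAdjoint_W.star_eq, (D.selfAdjoint_N δ).star_eq]
  exact (D.commute_N_W δ).eq.symm

theorem norm_one_sub_N_mul_T_le {δ : ℝ} (hδ : 0 < δ) :
    ‖(1 - D.N δ) * D.T‖ ≤ D.κ ^ 2 * δ ^ D.ε := by
  have hκ := D.κ_pos
  rw [D.T_eq, ← mul_assoc]
  calc _ ≤ ‖(1 - D.N δ) * D.W‖ * ‖D.T₁‖ := norm_mul_le _ _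
    _ ≤ (D.κ * δ ^ D.ε) * D.κ := by
      gcongr
      · exact D.norm_one_sub_N_mul_W_le δ hδ
      · exact D.norm_T₁_le
    _ = _ := by ring

theorem norm_T_mul_one_sub_N_le {δ : ℝ} (hδ : 0 < δ) :
    ‖D.T * (1 - D.N δ)‖ ≤ D.κ ^ 2 * δ ^ D.ε := by
  rw [← norm_star, star_mul, star_sub, D.selfAdjoint_T.star_eq, (D.selfAdjoint_N δ).star_eq,
    star_one]
  exact D.norm_one_sub_N_mul_T_le hδ

theorem norm_T_sub_le {δ : ℝ} (hδ : 0 < δ) :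
    ‖D.T - D.N δ * D.T * D.N δ‖ ≤ 2 * D.κ ^ 2 * δ ^ D.ε := by
  have e : D.T - D.N δ * D.T * D.N δ = (1 - D.N δ) * D.T + D.N δ * (D.T * (1 - D.N δ)) := by
    noncomm_ring
  rw [e]
  have h1 := D.norm_one_sub_N_mul_T_le hδ
  have h2 := D.norm_T_mul_one_sub_N_le hδ
  have h3 : ‖D.N δ * (D.T * (1 - D.N δ))‖ ≤ 1 * ‖D.T * (1 - D.N δ)‖ :=
    (norm_mul_le _ _).trans (by gcongr; exact D.norm_N_le δ hδ)
  have := norm_add_le ((1 - D.N δ) * D.T) (D.N δ * (D.T * (1 - D.N δ)))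
  linarith

/-- The contribution of the derivative of `N` to the derivative of the dissipative term. -/
def P (δ : ℝ) : E →L[ℂ] E :=
  D.N δ * (1 - D.N δ) * D.T * D.N δ + D.N δ * D.T * (D.N δ * (1 - D.N δ))

theorem norm_P_le {δ : ℝ} (hδ : 0 < δ) : ‖D.P δ‖ ≤ 2 * D.κ ^ 2 * δ ^ D.ε := by
  have h1 := D.norm_one_sub_N_mul_T_le hδ
  have h2 := D.norm_T_mul_one_sub_N_le hδ
  have hN := D.norm_N_le δ hδ
  have e : D.P δ = D.N δ * ((1 - D.N δ) * D.T) * D.N δ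
      + D.N δ * (D.T * (1 - D.N δ)) * D.N δ := by
    unfold P; noncomm_ring
  have key : ∀ X : E →L[ℂ] E, ‖D.N δ * X * D.N δ‖ ≤ ‖X‖ := fun X => by
    calc ‖D.N δ * X * D.N δ‖ ≤ ‖D.N δ‖ * ‖X‖ * ‖D.N δ‖ := norm_mul₃_le
      _ ≤ 1 * ‖X‖ * 1 := by gcongr
      _ = ‖X‖ := by ring
  rw [e]
  refine (norm_add_le _ _).trans ?_
  have := key ((1 - D.N δ) * D.T)
  have := key (D.T * (1 - D.N δ))
  linarith

theorem re_inner_M_ge {δ lam : ℝ} (hδ : D.Small δ) (hl : |lam - D.lam₀| < D.ρ) (f : E) :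
    D.c / 2 * ‖f‖ ^ 2 ≤ (inner ℂ f (D.M δ lam f)).re := by
  have h1 := D.positivity lam hl f
  have h2 := D.norm_T_sub_le hδ.1
  have h3 := hδ.2.2
  set X := D.H - (lam : ℂ) • (1 : E →L[ℂ] E) with hX
  have hXs : IsSelfAdjoint X := by
    refine D.selfAdjoint_H.sub ?_
    rw [IsSelfAdjoint, star_smul, star_one]
    simp
  have e : inner ℂ f (D.M δ lam f) = inner ℂ f ((D.B₀ + D.T) f)
      - inner ℂ f ((D.T - D.N δ * D.T * D.N δ) f) + D.C₀ * inner ℂ (X f) (X f) := by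
    have hx : inner ℂ (X f) (X f) = inner ℂ f ((X * X) f) := by
      have h := ContinuousLinearMap.adjoint_inner_right X f (X f)
      rw [← ContinuousLinearMap.star_eq_adjoint, hXs.star_eq] at h
      exact h.symm
    have hs : D.M δ lam = (D.B₀ + D.T) - (D.T - D.N δ * D.T * D.N δ) + (D.C₀ : ℂ) • (X * X) := by
      simp only [M, ← hX]; abel
    rw [hx, hs]
    rw [add_apply, sub_apply, inner_add_right,
      inner_sub_right, smul_apply, inner_smul_right]
  have h4 : (inner ℂ f ((D.T - D.N δ * D.T * D.N δ) f)).re ≤ D.c / 2 * ‖f‖ ^ 2 := by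
    refine (Complex.re_le_norm _).trans ((norm_inner_le_norm _ _).trans ?_)
    have := (D.T - D.N δ * D.T * D.N δ).le_opNorm f
    have h5 : ‖(D.T - D.N δ * D.T * D.N δ) f‖ ≤ D.c / 2 * ‖f‖ :=
      this.trans (by gcongr; linarith)
    nlinarith [norm_nonneg f]
  have h6 : ((D.C₀ : ℂ) * inner ℂ (X f) (X f)).re = D.C₀ * ‖X f‖ ^ 2 := by
    rw [inner_self_eq_norm_sq_to_K]
    simp only [Complex.coe_algebraMap]
    norm_cast
  rw [e, Complex.add_re, Complex.sub_re, h6]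
  linarith

theorem coercive {δ : ℝ} {z : ℂ} (hδ : D.Small δ) (hz : D.Admissible z) :
    FormCoercive (D.S δ z) (z.im + δ * (D.c / 2)) := by
  have hc := D.c_pos
  have h0 := hδ.1
  have hzi := hz.2.1
  refine ⟨by positivity, fun u => ?_⟩
  have h1 := D.re_inner_M_ge hδ hz.1 u
  have h2 : (inner ℂ u (D.H u)).im = 0 := by
    have := inner_conj_symm (𝕜 := ℂ) u (D.H u)
    rw [← ContinuousLinearMap.adjoint_inner_right, ← ContinuousLinearMap.star_eq_adjoint,
      D.selfAdjoint_H.star_eq] at this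
    exact Complex.conj_eq_iff_im.1 this
  have h3 : (inner ℂ u (D.S δ z u)).im
      = - (z.im * ‖u‖ ^ 2 + δ * (inner ℂ u (D.M δ z.re u)).re) := by
    have e : D.S δ z u = D.H u - z • u - (Complex.I * δ) • D.M δ z.re u := by
      simp [S]
    rw [e, inner_sub_right, inner_sub_right, inner_smul_right, inner_smul_right,
      inner_self_eq_norm_sq_to_K, Complex.sub_im, Complex.sub_im, h2]
    simp [Complex.mul_im, ← Complex.ofReal_pow]
    ring
  have h4 := Complex.abs_im_le_norm (inner ℂ u (D.S δ z u))
  rw [h3, abs_neg] at h4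
  have h5 := le_abs_self (z.im * ‖u‖ ^ 2 + δ * (inner ℂ u (D.M δ z.re u)).re)
  nlinarith

theorem mul_norm_G_le {δ : ℝ} {z : ℂ} (hδ : D.Small δ) (hz : D.Admissible z) :
    δ * ‖D.G δ z‖ ≤ 2 / D.c := by
  have h := (D.coercive hδ hz).norm_inverse_le
  have hc := D.c_pos
  have h0 := hδ.1
  have hzi := hz.2.1
  have : z.im * ‖D.G δ z‖ ≥ 0 := by positivity
  rw [le_div_iff₀ hc]
  change (z.im + δ * (D.c / 2)) * ‖D.G δ z‖ ≤ 1 at h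
  nlinarith

theorem im_mul_norm_G_le {δ : ℝ} {z : ℂ} (hδ : D.Small δ) (hz : D.Admissible z) :
    z.im * ‖D.G δ z‖ ≤ 1 := by
  have h := (D.coercive hδ hz).norm_inverse_le
  have hc := D.c_pos
  have h0 := hδ.1
  have : δ * (D.c / 2) * ‖D.G δ z‖ ≥ 0 := by positivity
  change (z.im + δ * (D.c / 2)) * ‖D.G δ z‖ ≤ 1 at h
  nlinarith

theorem mul_sq_norm_G_mul_Wd_le {δ : ℝ} {z : ℂ} (hδ : D.Small δ) (hz : D.Admissible z) :
    δ * ‖D.G δ z * D.Wd δ‖ ^ 2 ≤ 2 / D.c * ‖D.F δ z‖ := by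
  have h := (D.coercive hδ hz).sq_norm_inverse_mul_le (D.Wd δ)
  rw [(D.selfAdjoint_Wd δ).star_eq] at h
  change (z.im + δ * (D.c / 2)) * ‖D.G δ z * D.Wd δ‖ ^ 2 ≤ ‖D.F δ z‖ at h
  have hc := D.c_pos
  have hzi := hz.2.1
  have : z.im * ‖D.G δ z * D.Wd δ‖ ^ 2 ≥ 0 := by positivity
  rw [div_mul_eq_mul_div, le_div_iff₀ hc]
  linarith

theorem mul_sq_norm_Wd_mul_G_le {δ : ℝ} {z : ℂ} (hδ : D.Small δ) (hz : D.Admissible z) :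
    δ * ‖D.Wd δ * D.G δ z‖ ^ 2 ≤ 2 / D.c * ‖D.F δ z‖ := by
  have h := (D.coercive hδ hz).sq_norm_mul_inverse_le (D.Wd δ)
  rw [(D.selfAdjoint_Wd δ).star_eq] at h
  change (z.im + δ * (D.c / 2)) * ‖D.Wd δ * D.G δ z‖ ^ 2 ≤ ‖D.F δ z‖ at h
  have hc := D.c_pos
  have hzi := hz.2.1
  have : z.im * ‖D.Wd δ * D.G δ z‖ ^ 2 ≥ 0 := by positivity
  rw [div_mul_eq_mul_div, le_div_iff₀ hc]
  linarith

theorem S_mul_G {δ : ℝ} {z : ℂ} (hδ : D.Small δ) (hz : D.Admissible z) :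
    D.S δ z * D.G δ z = 1 := (D.coercive hδ hz).mul_inverse

theorem G_mul_S {δ : ℝ} {z : ℂ} (hδ : D.Small δ) (hz : D.Admissible z) :
    D.G δ z * D.S δ z = 1 := (D.coercive hδ hz).inverse_mul

theorem norm_NTN_le {δ : ℝ} (hδ : 0 < δ) : ‖D.N δ * D.T * D.N δ‖ ≤ D.κ ^ 2 := by
  have hN := D.norm_N_le δ hδ
  have hκ := D.κ_pos
  have hT : ‖D.T‖ ≤ D.κ * D.κ := by
    rw [D.T_eq]
    refine (norm_mul_le _ _).trans ?_
    gcongr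
    · exact D.norm_W_le
    · exact D.norm_T₁_le
  calc ‖D.N δ * D.T * D.N δ‖ ≤ ‖D.N δ‖ * ‖D.T‖ * ‖D.N δ‖ := norm_mul₃_le
    _ ≤ 1 * (D.κ * D.κ) * 1 := by gcongr
    _ = _ := by ring

theorem norm_M_le {δ lam : ℝ} (hδ : 0 < δ) (hl : |lam - D.lam₀| < D.ρ) :
    ‖D.M δ lam‖ ≤ 3 * D.κ ^ 3 := by
  have hκ := D.one_le_κ
  have h1 := D.norm_NTN_le hδ
  have h2 := D.norm_B₀_le
  have h3 := D.norm_H_sub_le lam hl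
  have h4 : ‖(D.C₀ : ℂ) • ((D.H - (lam : ℂ) • (1 : E →L[ℂ] E)) * (D.H - (lam : ℂ) • 1))‖
      ≤ D.κ * (D.κ * D.κ) := by
    rw [norm_smul, Complex.norm_real, Real.norm_eq_abs, abs_of_nonneg D.C₀_nonneg]
    gcongr
    · exact D.C₀_le
    · refine (norm_mul_le _ _).trans ?_
      gcongr
  have h5 : D.κ ≤ D.κ ^ 3 := by nlinarith [sq_nonneg D.κ]
  have h6 : D.κ ^ 2 ≤ D.κ ^ 3 := by nlinarith [sq_nonneg D.κ]
  unfold M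
  refine (norm_add_le _ _).trans ?_
  have := norm_add_le D.B₀ (D.N δ * D.T * D.N δ)
  nlinarith

theorem hasDerivAt_Wd {δ : ℝ} (hδ : 0 < δ) :
    HasDerivAt D.Wd (-(δ⁻¹ • (D.N δ * (1 - D.N δ) * D.W))) δ := by
  have h := (D.hasDerivAt_N δ hδ).mul_const D.W
  refine h.congr_deriv ?_
  rw [neg_mul, smul_mul_assoc]

theorem hasDerivAt_M {δ : ℝ} (hδ : 0 < δ) (lam : ℝ) :
    HasDerivAt (fun d => D.M d lam) (-(δ⁻¹ • D.P δ)) δ := by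
  have hN := D.hasDerivAt_N δ hδ
  have h := (((hN.mul_const D.T).mul hN).const_add D.B₀).add_const
    ((D.C₀ : ℂ) • ((D.H - (lam : ℂ) • 1) * (D.H - (lam : ℂ) • 1)))
  refine h.congr_deriv ?_
  simp only [P, neg_mul, mul_neg, smul_mul_assoc, mul_smul_comm, smul_add, neg_add]

theorem hasDerivAt_S {δ : ℝ} (hδ : 0 < δ) (z : ℂ) :
    HasDerivAt (fun d => D.S d z) (-(Complex.I • (D.M δ z.re - D.P δ))) δ := by
  have h1 : HasDerivAt (fun d : ℝ => Complex.I * (d : ℂ)) Complex.I δ := by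
    simpa using (Complex.ofRealCLM.hasDerivAt (x := δ)).const_mul Complex.I
  have h := (h1.smul (D.hasDerivAt_M hδ z.re)).const_sub (D.H - z • 1)
  refine h.congr_deriv ?_
  have e : ((Complex.I * (δ : ℂ)) • (-(δ⁻¹ • D.P δ)) : E →L[ℂ] E) = -(Complex.I • D.P δ) := by
    rw [smul_neg, ← Complex.coe_smul, smul_smul, Complex.ofReal_inv, mul_assoc,
      mul_inv_cancel₀ (by exact_mod_cast hδ.ne'), mul_one]
  rw [e, smul_sub]
  abel_nf

theorem hasDerivAt_G {δ : ℝ} {z : ℂ} (hδ : D.Small δ) (hz : D.Admissible z) :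
    HasDerivAt (fun d => D.G d z)
      (Complex.I • (D.G δ z * (D.M δ z.re - D.P δ) * D.G δ z)) δ := by
  obtain ⟨u, hu⟩ := (D.coercive hδ hz).isUnit
  have h1 := hasFDerivAt_ringInverse (𝕜 := ℝ) u
  have hG : (↑u⁻¹ : E →L[ℂ] E) = D.G δ z := by
    rw [G, ← hu, Ring.inverse_unit]
  rw [hu, hG] at h1
  have h := h1.comp_hasDerivAt δ (D.hasDerivAt_S hδ.1 z)
  refine h.congr_deriv ?_
  simp only [neg_apply, ContinuousLinearMap.mulLeftRight_apply, mul_neg, neg_mul, neg_neg,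
    mul_smul_comm, smul_mul_assoc]

/-- The derivative of `F` in the regularization parameter. -/
def F' (δ : ℝ) (z : ℂ) : E →L[ℂ] E :=
  -(δ⁻¹ • (D.N δ * (1 - D.N δ) * D.W)) * (D.G δ z * D.Wd δ)
    + (Complex.I • (D.Wd δ * D.G δ z * (D.M δ z.re - D.P δ) * (D.G δ z * D.Wd δ)))
    + D.Wd δ * D.G δ z * -(δ⁻¹ • (D.N δ * (1 - D.N δ) * D.W))

theorem hasDerivAt_F {δ : ℝ} {z : ℂ} (hδ : D.Small δ) (hz : D.Admissible z) :
    HasDerivAt (fun d => D.F d z) (D.F' δ z) δ := by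
  have h1 := D.hasDerivAt_Wd hδ.1
  have h := (h1.mul (D.hasDerivAt_G hδ hz)).mul h1
  refine h.congr_deriv ?_
  simp only [F', Pi.mul_apply, add_mul, mul_assoc, smul_mul_assoc, mul_smul_comm]

theorem norm_regularization_le {δ : ℝ} (hδ : 0 < δ) :
    ‖-(δ⁻¹ • (D.N δ * (1 - D.N δ) * D.W))‖ ≤ D.κ * δ ^ (D.ε - 1) := by
  have h1 := D.norm_one_sub_N_mul_W_le δ hδ
  have hN := D.norm_N_le δ hδ
  rw [norm_neg, norm_smul, norm_inv, Real.norm_of_nonneg hδ.le, mul_assoc]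
  have h2 : ‖D.N δ * ((1 - D.N δ) * D.W)‖ ≤ D.κ * δ ^ D.ε := by
    refine (norm_mul_le _ _).trans ?_
    nlinarith [norm_nonneg ((1 - D.N δ) * D.W)]
  rw [Real.rpow_sub_one hδ.ne', inv_mul_le_iff₀ hδ]
  calc _ ≤ _ := h2
    _ = _ := by field_simp

theorem norm_commutator_M_le {δ lam : ℝ} (hδ : 0 < δ) (hδ1 : δ ≤ 1)
    (hl : |lam - D.lam₀| < D.ρ) (L : ℕ) :
    ‖D.M δ lam * D.A L - D.A L * D.M δ lam‖ ≤ 5 * D.κ ^ 3 * δ ^ (D.ε - 1) := by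
  have hκ := D.one_le_κ
  have hκ0 := D.κ_pos
  have hN := D.norm_N_le δ hδ
  have hAW := D.norm_A_mul_N_mul_W_le L δ hδ
  have hε := D.ε_le_one
  have hw : 1 ≤ δ ^ (D.ε - 1) := Real.one_le_rpow_of_pos_of_le_one_of_nonpos hδ hδ1 (by linarith)
  set w := δ ^ (D.ε - 1) with hwdef
  set X := D.H - (lam : ℂ) • (1 : E →L[ℂ] E) with hX
  have hXn : ‖X‖ ≤ D.κ := D.norm_H_sub_le lam hl
  set Y := D.H * D.A L - D.A L * D.H with hY
  have hYn : ‖Y‖ ≤ D.κ := D.norm_commutator_H_le L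
  have hXY : X * D.A L - D.A L * X = Y := by
    rw [hX, hY, sub_mul, mul_sub, smul_mul_assoc, mul_smul_comm, one_mul, mul_one]; abel
  have e : D.M δ lam * D.A L - D.A L * D.M δ lam = (D.B₀ * D.A L - D.A L * D.B₀)
      + (D.N δ * D.T * D.N δ * D.A L - D.A L * (D.N δ * D.T * D.N δ))
      + (D.C₀ : ℂ) • (X * Y + Y * X) := by
    rw [← hXY, M, ← hX]
    simp only [add_mul, mul_add, mul_sub, sub_mul, smul_mul_assoc, mul_smul_comm, mul_assoc,
      smul_add, smul_sub]
    abel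
  have h1 : ‖D.A L * (D.N δ * D.T * D.N δ)‖ ≤ D.κ ^ 2 * w := by
    have e1 : D.A L * (D.N δ * D.T * D.N δ) = (D.A L * (D.N δ * D.W)) * D.T₁ * D.N δ := by
      rw [D.T_eq]; simp only [mul_assoc]
    rw [e1]
    calc _ ≤ ‖D.A L * (D.N δ * D.W)‖ * ‖D.T₁‖ * ‖D.N δ‖ := norm_mul₃_le
      _ ≤ (D.κ * w) * D.κ * 1 := by gcongr; exact D.norm_T₁_le
      _ = _ := by ring
  have h2 : ‖D.N δ * D.T * D.N δ * D.A L‖ ≤ D.κ ^ 2 * w := by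
    rw [← norm_star]
    simpa only [star_mul, D.selfAdjoint_T.star_eq, (D.selfAdjoint_N δ).star_eq,
      (D.selfAdjoint_A L).star_eq, mul_assoc] using h1
  have h3 : ‖(D.C₀ : ℂ) • (X * Y + Y * X)‖ ≤ D.κ * (D.κ * D.κ + D.κ * D.κ) := by
    rw [norm_smul, Complex.norm_real, Real.norm_eq_abs, abs_of_nonneg D.C₀_nonneg]
    gcongr
    · exact D.C₀_le
    · refine (norm_add_le _ _).trans ?_
      gcongr
      · exact (norm_mul_le _ _).trans (by gcongr)
      · exact (norm_mul_le _ _).trans (by gcongr)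
  have h4 := D.norm_commutator_B₀_le L
  have h5 : D.κ ≤ D.κ ^ 3 := by nlinarith [sq_nonneg D.κ]
  have h6 : D.κ ^ 2 ≤ D.κ ^ 3 := by nlinarith [sq_nonneg D.κ]
  have h7 : D.κ ^ 3 ≤ D.κ ^ 3 * w := le_mul_of_one_le_right (by positivity) hw
  have h8 : D.κ ^ 2 * w ≤ D.κ ^ 3 * w := by gcongr
  rw [e]
  have t1 := norm_add_le ((D.B₀ * D.A L - D.A L * D.B₀)
      + (D.N δ * D.T * D.N δ * D.A L - D.A L * (D.N δ * D.T * D.N δ)))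
      ((D.C₀ : ℂ) • (X * Y + Y * X))
  have t2 := norm_add_le (D.B₀ * D.A L - D.A L * D.B₀)
      (D.N δ * D.T * D.N δ * D.A L - D.A L * (D.N δ * D.T * D.N δ))
  have t3 := norm_sub_le (D.N δ * D.T * D.N δ * D.A L) (D.A L * (D.N δ * D.T * D.N δ))
  nlinarith

theorem norm_sandwich_commutator_le {δ : ℝ} {z : ℂ} (hδ : D.Small δ) (hz : D.Admissible z) :
    ‖D.Wd δ * D.G δ z * (D.B₀ + D.T) * (D.G δ z * D.Wd δ)‖ ≤
      D.κ * δ ^ (D.ε - 1) * (‖D.G δ z * D.Wd δ‖ + ‖D.Wd δ * D.G δ z‖)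
      + δ * ‖D.Wd δ * D.G δ z‖ * (5 * D.κ ^ 3 * δ ^ (D.ε - 1)) * ‖D.G δ z * D.Wd δ‖ := by
  have hκ := D.κ_pos
  have h0 := hδ.1
  set R := D.κ * δ ^ (D.ε - 1) * (‖D.G δ z * D.Wd δ‖ + ‖D.Wd δ * D.G δ z‖)
      + δ * ‖D.Wd δ * D.G δ z‖ * (5 * D.κ ^ 3 * δ ^ (D.ε - 1)) * ‖D.G δ z * D.Wd δ‖ with hR
  have hR0 : 0 ≤ R := by positivity
  have main : ∀ L, ‖D.Wd δ * D.G δ z * (D.H * D.A L - D.A L * D.H) * (D.G δ z * D.Wd δ)‖ ≤ R := by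
    intro L
    have hAW : ‖D.A L * D.Wd δ‖ ≤ D.κ * δ ^ (D.ε - 1) := D.norm_A_mul_N_mul_W_le L δ h0
    have hWA : ‖D.Wd δ * D.A L‖ ≤ D.κ * δ ^ (D.ε - 1) := by
      rwa [← norm_star, star_mul, (D.selfAdjoint_A L).star_eq, (D.selfAdjoint_Wd δ).star_eq]
    have hM := D.norm_commutator_M_le h0 hδ.2.1 hz.1 L
    have hSG := D.S_mul_G hδ hz
    have hGS := D.G_mul_S hδ hz
    have hH : D.H * D.A L - D.A L * D.H = (D.S δ z * D.A L - D.A L * D.S δ z)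
        + (Complex.I * δ) • (D.M δ z.re * D.A L - D.A L * D.M δ z.re) := by
      simp only [S, sub_mul, mul_sub, smul_mul_assoc, mul_smul_comm, smul_sub, one_mul, mul_one]
      abel
    have e : D.Wd δ * D.G δ z * (D.H * D.A L - D.A L * D.H) * (D.G δ z * D.Wd δ)
        = (D.Wd δ * D.A L) * (D.G δ z * D.Wd δ) - (D.Wd δ * D.G δ z) * (D.A L * D.Wd δ)
          + (Complex.I * δ) • ((D.Wd δ * D.G δ z) *
            (D.M δ z.re * D.A L - D.A L * D.M δ z.re) * (D.G δ z * D.Wd δ)) := by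
      have e1 : D.Wd δ * D.G δ z * (D.S δ z * D.A L - D.A L * D.S δ z) * (D.G δ z * D.Wd δ)
          = D.Wd δ * (D.G δ z * D.S δ z) * D.A L * (D.G δ z * D.Wd δ)
            - (D.Wd δ * D.G δ z) * D.A L * (D.S δ z * D.G δ z) * D.Wd δ := by
        noncomm_ring
      rw [hH, mul_add, add_mul, e1, hSG, hGS, mul_smul_comm, smul_mul_assoc]
      simp only [mul_one, mul_assoc]
    rw [e]
    refine (norm_add_le _ _).trans (add_le_add ((norm_sub_le _ _).trans ?_) ?_)
    · rw [mul_add]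
      refine add_le_add ((norm_mul_le _ _).trans (by gcongr)) ((norm_mul_le _ _).trans ?_)
      rw [mul_comm]
      gcongr
    · rw [norm_smul, norm_mul, Complex.norm_I, one_mul, Complex.norm_real,
        Real.norm_of_nonneg h0.le]
      have := norm_mul₃_le (a := D.Wd δ * D.G δ z)
        (b := D.M δ z.re * D.A L - D.A L * D.M δ z.re) (c := D.G δ z * D.Wd δ)
      calc _ ≤ δ * (‖D.Wd δ * D.G δ z‖ * ‖D.M δ z.re * D.A L - D.A L * D.M δ z.re‖
            * ‖D.G δ z * D.Wd δ‖) := by gcongr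
        _ ≤ δ * (‖D.Wd δ * D.G δ z‖ * (5 * D.κ ^ 3 * δ ^ (D.ε - 1)) * ‖D.G δ z * D.Wd δ‖) := by
          gcongr
        _ = _ := by ring
  refine norm_le_of_forall_inner_le hR0 fun f g => ?_
  set X := D.Wd δ * D.G δ z with hX
  set Y := D.G δ z * D.Wd δ with hY
  have hadj : ∀ Z : E →L[ℂ] E, inner ℂ f ((X * Z * Y) g) = inner ℂ (star X f) (Z (Y g)) :=
    fun Z => by
      rw [ContinuousLinearMap.star_eq_adjoint, ContinuousLinearMap.adjoint_inner_left]; rfl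
  have hlim := (D.tendsto_commutator (star X f) (Y g)).norm
  rw [hadj]
  rw [inner_neg_right, inner_smul_right, norm_neg, norm_mul, Complex.norm_I, one_mul] at hlim
  refine le_of_tendsto hlim (Filter.Eventually.of_forall fun L => ?_)
  rw [← hadj]
  refine (norm_inner_le_norm _ _).trans ?_
  have := (X * (D.H * D.A L - D.A L * D.H) * Y).le_opNorm g
  calc _ ≤ ‖f‖ * (R * ‖g‖) := by
        gcongr
        exact this.trans (by gcongr; exact main L)
    _ = _ := by ring

theorem norm_H_sub_mul_G_le {δ : ℝ} {z : ℂ} (hδ : D.Small δ) (hz : D.Admissible z) :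
    ‖(D.H - (z.re : ℂ) • 1) * D.G δ z‖ ≤ 2 + 6 * D.κ ^ 3 / D.c ∧
      ‖D.G δ z * (D.H - (z.re : ℂ) • 1)‖ ≤ 2 + 6 * D.κ ^ 3 / D.c := by
  have hc := D.c_pos
  have hκ := D.κ_pos
  have h0 := hδ.1
  have hzi := hz.2.1
  have h1 := D.mul_norm_G_le hδ hz
  have h2 := D.im_mul_norm_G_le hδ hz
  have hM := D.norm_M_le h0 hz.1
  have e : D.H - (z.re : ℂ) • 1 = D.S δ z + (Complex.I * z.im) • (1 : E →L[ℂ] E)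
      + (Complex.I * δ) • D.M δ z.re := by
    have hzz : z • (1 : E →L[ℂ] E) = (z.re : ℂ) • 1 + (Complex.I * z.im) • 1 := by
      rw [← add_smul]; congr 1; rw [mul_comm]; exact (Complex.re_add_im z).symm
    rw [S, hzz]; abel
  have n1 : ‖(1 : E →L[ℂ] E)‖ ≤ 1 := ContinuousLinearMap.norm_id_le
  have n2 : ‖(Complex.I * z.im) • D.G δ z‖ ≤ 1 := by
    rw [norm_smul, norm_mul, Complex.norm_I, one_mul, Complex.norm_real,
        Real.norm_of_nonneg hzi.le]
    exact h2
  have hb : δ * (3 * D.κ ^ 3 * ‖D.G δ z‖) ≤ 6 * D.κ ^ 3 / D.c := by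
    calc δ * (3 * D.κ ^ 3 * ‖D.G δ z‖) = 3 * D.κ ^ 3 * (δ * ‖D.G δ z‖) := by ring
      _ ≤ 3 * D.κ ^ 3 * (2 / D.c) := by gcongr
      _ = _ := by ring
  have n3 : ∀ X : E →L[ℂ] E, ‖X‖ ≤ 3 * D.κ ^ 3 * ‖D.G δ z‖ →
      ‖(Complex.I * δ) • X‖ ≤ 6 * D.κ ^ 3 / D.c := fun X hX => by
    rw [norm_smul, norm_mul, Complex.norm_I, one_mul, Complex.norm_real,
        Real.norm_of_nonneg h0.le]
    exact le_trans (by gcongr) hb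
  constructor
  · rw [e, add_mul, add_mul, D.S_mul_G hδ hz, smul_mul_assoc, one_mul, smul_mul_assoc]
    have n4 := n3 (D.M δ z.re * D.G δ z) ((norm_mul_le _ _).trans (by gcongr))
    refine (norm_add_le _ _).trans (add_le_add ((norm_add_le _ _).trans ?_) n4)
    linarith
  · rw [e, mul_add, mul_add, D.G_mul_S hδ hz, mul_smul_comm, mul_one, mul_smul_comm]
    have n4 := n3 (D.G δ z * D.M δ z.re) ((norm_mul_le _ _).trans (by rw [mul_comm]; gcongr))
    refine (norm_add_le _ _).trans (add_le_add ((norm_add_le _ _).trans ?_) n4)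
    linarith

theorem norm_Wd_le {δ : ℝ} (hδ : 0 < δ) : ‖D.Wd δ‖ ≤ D.κ := by
  have hN := D.norm_N_le δ hδ
  refine (norm_mul_le _ _).trans ?_
  have := D.norm_W_le
  nlinarith [norm_nonneg D.W]

theorem norm_F'_le_aux {δ : ℝ} {z : ℂ} (hδ : D.Small δ) (hz : D.Admissible z) :
    ‖D.F' δ z‖ ≤
      2 * (D.κ * δ ^ (D.ε - 1)) * (‖D.G δ z * D.Wd δ‖ + ‖D.Wd δ * D.G δ z‖)
      + (δ * (‖D.Wd δ * D.G δ z‖ * ‖D.G δ z * D.Wd δ‖))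
        * ((5 * D.κ ^ 3 + 4 * D.κ ^ 2) * δ ^ (D.ε - 1))
      + D.κ ^ 3 * (2 + 6 * D.κ ^ 3 / D.c) ^ 2 := by
  have hκ := D.κ_pos
  have hc := D.c_pos
  have h0 := hδ.1
  set g := ‖D.G δ z * D.Wd δ‖ with hg
  set g' := ‖D.Wd δ * D.G δ z‖ with hg'
  set e := δ ^ (D.ε - 1) with he
  set k := 2 + 6 * D.κ ^ 3 / D.c with hk
  have hε : δ ^ D.ε = δ * e := by rw [he, Real.rpow_sub_one h0.ne']; field_simp
  have hU := D.norm_regularization_le h0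
  rw [← he] at hU
  set U := -(δ⁻¹ • (D.N δ * (1 - D.N δ) * D.W)) with hUdef
  set X := D.H - (z.re : ℂ) • (1 : E →L[ℂ] E) with hX
  obtain ⟨hX1, hX2⟩ := D.norm_H_sub_mul_G_le hδ hz
  rw [← hX, ← hk] at hX1 hX2
  have hB := D.norm_sandwich_commutator_le hδ hz
  rw [← hg, ← hg', ← he] at hB
  have hT := D.norm_T_sub_le h0
  have hP := D.norm_P_le h0
  have hW := D.norm_Wd_le h0
  rw [hε] at hT hP
  have e2 : D.Wd δ * D.G δ z * (D.M δ z.re - D.P δ) * (D.G δ z * D.Wd δ)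
      = D.Wd δ * D.G δ z * (D.B₀ + D.T) * (D.G δ z * D.Wd δ)
        - D.Wd δ * D.G δ z * (D.T - D.N δ * D.T * D.N δ) * (D.G δ z * D.Wd δ)
        - D.Wd δ * D.G δ z * D.P δ * (D.G δ z * D.Wd δ)
        + (D.C₀ : ℂ) • ((D.Wd δ * (D.G δ z * X)) * ((X * D.G δ z) * D.Wd δ)) := by
    have hM : D.M δ z.re - D.P δ = (D.B₀ + D.T) - (D.T - D.N δ * D.T * D.N δ) - D.P δ
        + (D.C₀ : ℂ) • (X * X) := by
      rw [M, ← hX]; abel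
    rw [hM, mul_add, add_mul, mul_sub, mul_sub, sub_mul, sub_mul, mul_smul_comm, smul_mul_assoc]
    simp only [mul_assoc]
  have n1 : ‖U * (D.G δ z * D.Wd δ)‖ ≤ D.κ * e * g := (norm_mul_le _ _).trans (by gcongr)
  have n2 : ‖D.Wd δ * D.G δ z * U‖ ≤ D.κ * e * g' :=
    (norm_mul_le _ _).trans (by rw [mul_comm]; gcongr)
  have n3 : ‖D.Wd δ * D.G δ z * (D.T - D.N δ * D.T * D.N δ) * (D.G δ z * D.Wd δ)‖
      ≤ g' * (2 * D.κ ^ 2 * (δ * e)) * g := norm_mul₃_le.trans (by gcongr)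
  have n4 : ‖D.Wd δ * D.G δ z * D.P δ * (D.G δ z * D.Wd δ)‖
      ≤ g' * (2 * D.κ ^ 2 * (δ * e)) * g := norm_mul₃_le.trans (by gcongr)
  have hk0 : 0 ≤ k := by positivity
  have n5 : ‖(D.C₀ : ℂ) • ((D.Wd δ * (D.G δ z * X)) * ((X * D.G δ z) * D.Wd δ))‖
      ≤ D.κ * ((D.κ * k) * (k * D.κ)) := by
    rw [norm_smul, Complex.norm_real, Real.norm_eq_abs, abs_of_nonneg D.C₀_nonneg]
    gcongr
    · exact D.C₀_le
    · refine (norm_mul_le _ _).trans ?_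
      gcongr
      · exact (norm_mul_le _ _).trans (by gcongr)
      · exact (norm_mul_le _ _).trans (by gcongr)
  have n6 : ‖Complex.I • (D.Wd δ * D.G δ z * (D.M δ z.re - D.P δ) * (D.G δ z * D.Wd δ))‖
      ≤ (D.κ * e * (g + g') + δ * g' * (5 * D.κ ^ 3 * e) * g)
        + g' * (2 * D.κ ^ 2 * (δ * e)) * g + g' * (2 * D.κ ^ 2 * (δ * e)) * g
        + D.κ * ((D.κ * k) * (k * D.κ)) := by
    rw [norm_smul, Complex.norm_I, one_mul, e2]
    refine (norm_add_le _ _).trans (add_le_add ?_ n5)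
    refine (norm_sub_le _ _).trans (add_le_add ?_ n4)
    exact (norm_sub_le _ _).trans (add_le_add hB n3)
  have n7 := norm_add₃_le (a := U * (D.G δ z * D.Wd δ))
    (b := Complex.I • (D.Wd δ * D.G δ z * (D.M δ z.re - D.P δ) * (D.G δ z * D.Wd δ)))
    (c := D.Wd δ * D.G δ z * U)
  change ‖D.F' δ z‖ ≤ _ at n7
  refine n7.trans ((add_le_add (add_le_add n1 n6) n2).trans (le_of_eq ?_))
  ring

theorem norm_F'_le : ∃ K : ℝ, 0 < K ∧ ∀ δ z, D.Small δ → D.Admissible z →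
    ‖D.F' δ z‖ ≤ K * δ ^ (D.ε - 3 / 2) * (‖D.F δ z‖ + 1) := by
  have hκ := D.κ_pos
  have hc := D.c_pos
  set k := 2 + 6 * D.κ ^ 3 / D.c with hk
  have hk0 : 0 < k := by positivity
  refine ⟨(4 * D.κ + (5 * D.κ ^ 3 + 4 * D.κ ^ 2) + D.κ ^ 3 * k ^ 2) * (1 + 2 / D.c),
    by positivity, fun δ z hδ hz => (D.norm_F'_le_aux hδ hz).trans ?_⟩
  rw [← hk]
  have h0 := hδ.1
  have hε := D.ε_le_one
  have a1 := D.mul_sq_norm_G_mul_Wd_le hδ hz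
  have a2 := D.mul_sq_norm_Wd_mul_G_le hδ hz
  set g := ‖D.G δ z * D.Wd δ‖ with hg
  set g' := ‖D.Wd δ * D.G δ z‖ with hg'
  set e := δ ^ (D.ε - 1) with he
  set w := δ ^ (D.ε - 3 / 2) with hw
  set x := 2 / D.c * ‖D.F δ z‖ with hx
  have hx0 : 0 ≤ x := by positivity
  set s := δ ^ (-(1 / 2) : ℝ) with hs
  have hs0 : 0 < s := by positivity
  have he0 : 0 < e := by positivity
  have hss : s * s * δ = 1 := by
    rw [hs, ← Real.rpow_add h0, ← Real.rpow_add_one h0.ne']; norm_num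
  have hes : e * s = w := by
    rw [he, hs, ← Real.rpow_add h0]; congr 1; ring
  have hew : e ≤ w := Real.rpow_le_rpow_of_exponent_ge h0 hδ.2.1 (by linarith)
  have h1w : 1 ≤ w := Real.one_le_rpow_of_pos_of_le_one_of_nonpos h0 hδ.2.1 (by linarith)
  have key : ∀ t : ℝ, 0 ≤ t → δ * t ^ 2 ≤ x → t ≤ s * (1 + x) := fun t ht h => by
    refine (abs_le_of_sq_le_sq' ?_ (by positivity)).2
    have : t ^ 2 = s * s * (δ * t ^ 2) := by linear_combination (-t ^ 2) * hss
    rw [this, mul_pow, sq s]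
    gcongr
    nlinarith
  have b1 := key g (norm_nonneg _) a1
  have b2 := key g' (norm_nonneg _) a2
  have b3 : δ * (g' * g) ≤ x := by nlinarith [sq_nonneg (g - g')]
  have c1 : 2 * (D.κ * e) * (g + g') ≤ 4 * D.κ * w * (1 + x) := by
    calc 2 * (D.κ * e) * (g + g') ≤ 2 * (D.κ * e) * (s * (1 + x) + s * (1 + x)) := by gcongr
      _ = 4 * D.κ * (e * s) * (1 + x) := by ring
      _ = _ := by rw [hes]
  have c2 : δ * (g' * g) * ((5 * D.κ ^ 3 + 4 * D.κ ^ 2) * e)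
      ≤ (1 + x) * ((5 * D.κ ^ 3 + 4 * D.κ ^ 2) * w) := by
    gcongr
    linarith
  have c3 : D.κ ^ 3 * k ^ 2 ≤ D.κ ^ 3 * k ^ 2 * (w * (1 + x)) :=
    le_mul_of_one_le_right (by positivity) (by nlinarith)
  have c4 : 1 + x ≤ (1 + 2 / D.c) * (‖D.F δ z‖ + 1) := by
    have : 0 ≤ 2 / D.c := by positivity
    have := norm_nonneg (D.F δ z)
    rw [hx]; nlinarith
  calc _ ≤ 4 * D.κ * w * (1 + x) + (1 + x) * ((5 * D.κ ^ 3 + 4 * D.κ ^ 2) * w)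
        + D.κ ^ 3 * k ^ 2 * (w * (1 + x)) := add_le_add (add_le_add c1 c2) c3
    _ = (4 * D.κ + (5 * D.κ ^ 3 + 4 * D.κ ^ 2) + D.κ ^ 3 * k ^ 2) * w * (1 + x) := by ring
    _ ≤ (4 * D.κ + (5 * D.κ ^ 3 + 4 * D.κ ^ 2) + D.κ ^ 3 * k ^ 2) * w
        * ((1 + 2 / D.c) * (‖D.F δ z‖ + 1)) := by gcongr
    _ = _ := by ring

omit [InnerProductSpace ℂ E] [CompleteSpace E] in
/-- If `‖f'‖ ≤ K δ ^ (θ - 1) (‖f‖ + 1)` on `(0, δ₀]` with `θ > 0` then `f` is bounded and its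
oscillation on `(0, δ]` is `O(δ ^ θ)`, with constants depending only on `‖f δ₀‖`, `K`, `θ`. -/
theorem exists_holder_of_norm_deriv_le [NormedSpace ℝ E] {θ K δ₀ R : ℝ} (hθ : 0 < θ) (hK : 0 < K)
    (hδ₀ : 0 < δ₀) :
    ∃ C : ℝ, 0 ≤ C ∧ ∀ f f' : ℝ → E, (∀ δ ∈ Set.Ioc 0 δ₀, HasDerivAt f (f' δ) δ) →
      (∀ δ ∈ Set.Ioc 0 δ₀, ‖f' δ‖ ≤ K * δ ^ (θ - 1) * (‖f δ‖ + 1)) → ‖f δ₀‖ ≤ R →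
      ∀ δ ∈ Set.Ioc 0 δ₀, ∀ δ' ∈ Set.Ioc 0 δ, ‖f δ' - f δ‖ ≤ C * δ ^ θ := by
  set B := max (gronwallBound (max R 0) (K / θ) (K / θ) (δ₀ ^ θ)) 0 with hB
  have hB0 : 0 ≤ B := le_max_right _ _
  refine ⟨K / θ * (B + 1), by positivity, fun f f' hf hf' hR δ hδ δ' hδ' => ?_⟩
  set s₁ := δ₀ ^ θ with hs₁
  have hs₁0 : 0 < s₁ := by positivity
  set h : ℝ → E := fun s => f ((s₁ - s) ^ (1 / θ)) with hh
  set h' : ℝ → E := fun s => (-(1 / θ * (s₁ - s) ^ (1 / θ - 1))) • f' ((s₁ - s) ^ (1 / θ)) with hh'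
  have hmem : ∀ s ∈ Set.Ico 0 s₁, (s₁ - s) ^ (1 / θ) ∈ Set.Ioc 0 δ₀ := by
    intro s hs
    have h1 : 0 < s₁ - s := by linarith [hs.2]
    refine ⟨by positivity, ?_⟩
    calc (s₁ - s) ^ (1 / θ) ≤ s₁ ^ (1 / θ) := by gcongr; linarith [hs.1]
      _ = δ₀ := by rw [hs₁, one_div, Real.rpow_rpow_inv hδ₀.le hθ.ne']
  have hderiv : ∀ s ∈ Set.Ico 0 s₁, HasDerivAt h (h' s) s := by
    intro s hs
    have h1 : 0 < s₁ - s := by linarith [hs.2]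
    have h2 : HasDerivAt (fun s : ℝ => (s₁ - s) ^ (1 / θ))
        (-(1 / θ * (s₁ - s) ^ (1 / θ - 1))) s := by
      have := ((hasDerivAt_id s).const_sub s₁).rpow_const (p := 1 / θ) (Or.inl h1.ne')
      refine this.congr_deriv ?_
      simp
    exact HasDerivAt.scomp s (hf _ (hmem s hs)) h2
  have hbound : ∀ s ∈ Set.Ico 0 s₁, ‖h' s‖ ≤ K / θ * ‖h s‖ + K / θ := by
    intro s hs
    have h1 : 0 < s₁ - s := by linarith [hs.2]
    have h3 := hf' _ (hmem s hs)
    have e : (s₁ - s) ^ (1 / θ - 1) * ((s₁ - s) ^ (1 / θ)) ^ (θ - 1) = 1 := by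
      rw [← Real.rpow_mul h1.le, ← Real.rpow_add h1]
      convert Real.rpow_zero _ using 2
      field_simp
      ring_nf
    rw [hh', norm_smul, norm_neg, Real.norm_of_nonneg (by positivity)]
    calc _ ≤ 1 / θ * (s₁ - s) ^ (1 / θ - 1) *
          (K * ((s₁ - s) ^ (1 / θ)) ^ (θ - 1) * (‖h s‖ + 1)) := by gcongr
      _ = ((s₁ - s) ^ (1 / θ - 1) * ((s₁ - s) ^ (1 / θ)) ^ (θ - 1)) *
          (K / θ * ‖h s‖ + K / θ) := by ring
      _ = _ := by rw [e, one_mul]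
  have h0 : ‖h 0‖ ≤ max R 0 := by
    refine le_trans (le_of_eq ?_) (hR.trans (le_max_left _ _))
    rw [hh, hs₁]
    simp only [sub_zero, one_div, Real.rpow_rpow_inv hδ₀.le hθ.ne']
  have hnorm : ∀ s ∈ Set.Ico 0 s₁, ‖h s‖ ≤ B := by
    intro s hs
    have hsub : Set.Icc 0 s ⊆ Set.Ico 0 s₁ := fun t ht => ⟨ht.1, lt_of_le_of_lt ht.2 hs.2⟩
    have := norm_le_gronwallBound_of_norm_deriv_right_le (f := h) (f' := h')
      (fun t ht => (hderiv t (hsub ht)).continuousAt.continuousWithinAt)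
      (fun t ht => (hderiv t (hsub ⟨ht.1, ht.2.le⟩)).hasDerivWithinAt) h0
      (fun t ht => hbound t (hsub ⟨ht.1, ht.2.le⟩)) s ⟨hs.1, le_rfl⟩
    refine this.trans (le_trans ?_ (le_max_left _ _))
    refine gronwallBound_mono (le_max_right _ _) (by positivity) (by positivity) ?_
    linarith [hs.2]
  have hlip : ∀ s ∈ Set.Ico 0 s₁, ∀ t ∈ Set.Ico 0 s₁, ‖h t - h s‖ ≤ K / θ * (B + 1) * ‖t - s‖ := by
    intro s hs t ht
    refine Convex.norm_image_sub_le_of_norm_hasDerivWithin_le (f' := h') (s := Set.Ico 0 s₁)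
      (fun x hx => (hderiv x hx).hasDerivWithinAt) (fun x hx => ?_) (convex_Ico _ _) hs ht
    refine (hbound x hx).trans ?_
    rw [mul_add, mul_one]
    gcongr
    exact hnorm x hx
  have hin : ∀ d ∈ Set.Ioc 0 δ₀, s₁ - d ^ θ ∈ Set.Ico 0 s₁ ∧ h (s₁ - d ^ θ) = f d := by
    intro d hd
    have hd0 := hd.1
    have h1 : 0 < d ^ θ := by positivity
    refine ⟨⟨?_, by linarith⟩, ?_⟩
    · have : d ^ θ ≤ δ₀ ^ θ := by gcongr; exact hd.2
      linarith
    · simp only [hh, sub_sub_cancel, one_div, Real.rpow_rpow_inv hd0.le hθ.ne']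
  obtain ⟨i1, e1⟩ := hin δ hδ
  obtain ⟨i2, e2⟩ := hin δ' ⟨hδ'.1, hδ'.2.trans hδ.2⟩
  have := hlip _ i1 _ i2
  rw [e1, e2] at this
  refine this.trans ?_
  have hd0 := hδ.1
  have hd0' := hδ'.1
  have l1 : 0 < δ' ^ θ := by positivity
  have l2 : δ' ^ θ ≤ δ ^ θ := by gcongr; exact hδ'.2
  gcongr
  rw [Real.norm_eq_abs, abs_le]
  constructor <;> linarith

theorem exists_small : ∃ δ₀, D.Small δ₀ := by
  have hε := D.half_lt_ε
  have hc := D.c_pos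
  have h1 : Filter.Tendsto (fun δ : ℝ => 2 * D.κ ^ 2 * δ ^ D.ε) (nhdsWithin 0 (Set.Ioi 0))
      (nhds 0) := by
    have := ((Real.continuousAt_rpow_const 0 D.ε (Or.inr (by linarith))).const_mul
      (2 * D.κ ^ 2)).tendsto
    rw [Real.zero_rpow (by linarith), mul_zero] at this
    exact this.mono_left nhdsWithin_le_nhds
  have h2 := h1.eventually_le_const (show (0 : ℝ) < D.c / 2 by positivity)
  have h3 : ∀ᶠ δ : ℝ in nhdsWithin 0 (Set.Ioi 0), δ ∈ Set.Ioc (0 : ℝ) 1 :=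
    Ioc_mem_nhdsGT one_pos
  obtain ⟨δ, h4, h5⟩ := (h2.and h3).exists
  exact ⟨δ, h5.1, h5.2, h4⟩

variable {D} in
theorem Small.mono {δ δ' : ℝ} (h : D.Small δ) (h0 : 0 < δ') (hle : δ' ≤ δ) : D.Small δ' := by
  have hε := D.half_lt_ε
  refine ⟨h0, hle.trans h.2.1, le_trans ?_ h.2.2⟩
  gcongr

/-- The weighted resolvent. -/
def weightedResolvent (z : ℂ) : E →L[ℂ] E := D.W * Ring.inverse (D.H - z • 1) * D.W

theorem tendsto_F {z : ℂ} (hz : D.Admissible z) :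
    Filter.Tendsto (fun δ => D.F δ z) (nhdsWithin 0 (Set.Ioi 0))
      (nhds (D.weightedResolvent z)) := by
  have hε := D.half_lt_ε
  have hpos : ∀ᶠ δ : ℝ in nhdsWithin 0 (Set.Ioi 0), 0 < δ := eventually_mem_nhdsWithin
  have hW : Filter.Tendsto D.Wd (nhdsWithin 0 (Set.Ioi 0)) (nhds D.W) := by
    rw [tendsto_iff_norm_sub_tendsto_zero]
    refine squeeze_zero' (Filter.Eventually.of_forall fun _ => norm_nonneg _)
      (g := fun δ => D.κ * δ ^ D.ε) ?_ ?_
    · filter_upwards [hpos] with δ hδ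
      have := D.norm_one_sub_N_mul_W_le δ hδ
      rw [norm_sub_rev]
      rwa [sub_mul, one_mul] at this
    · have := ((Real.continuousAt_rpow_const 0 D.ε (Or.inr (by linarith))).const_mul D.κ).tendsto
      rw [Real.zero_rpow (by linarith), mul_zero] at this
      exact this.mono_left nhdsWithin_le_nhds
  have hS : Filter.Tendsto (fun δ => D.S δ z) (nhdsWithin 0 (Set.Ioi 0))
      (nhds (D.H - z • 1)) := by
    rw [tendsto_iff_norm_sub_tendsto_zero]
    refine squeeze_zero' (Filter.Eventually.of_forall fun _ => norm_nonneg _)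
      (g := fun δ => δ * (3 * D.κ ^ 3)) ?_ ?_
    · filter_upwards [hpos] with δ hδ
      have := D.norm_M_le hδ hz.1
      rw [S, sub_sub_cancel_left, norm_neg, norm_smul, norm_mul, Complex.norm_I, one_mul,
        Complex.norm_real, Real.norm_of_nonneg hδ.le]
      gcongr
    · have : Filter.Tendsto (fun δ : ℝ => δ * (3 * D.κ ^ 3)) (nhds 0) (nhds (0 * (3 * D.κ ^ 3))) :=
        Filter.tendsto_id.mul_const _
      rw [zero_mul] at this
      exact this.mono_left nhdsWithin_le_nhds
  have hco : FormCoercive (D.H - z • 1) z.im := by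
    refine ⟨hz.2.1, fun u => ?_⟩
    have h2 : (inner ℂ u (D.H u)).im = 0 := by
      have := inner_conj_symm (𝕜 := ℂ) u (D.H u)
      rw [← ContinuousLinearMap.adjoint_inner_right, ← ContinuousLinearMap.star_eq_adjoint,
        D.selfAdjoint_H.star_eq] at this
      exact Complex.conj_eq_iff_im.1 this
    have h3 : (inner ℂ u ((D.H - z • (1 : E →L[ℂ] E)) u)).im = - (z.im * ‖u‖ ^ 2) := by
      have e : (D.H - z • (1 : E →L[ℂ] E)) u = D.H u - z • u := by simp
      rw [e, inner_sub_right, inner_smul_right, inner_self_eq_norm_sq_to_K, Complex.sub_im, h2]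
      simp [Complex.mul_im, ← Complex.ofReal_pow]
    have h4 := Complex.abs_im_le_norm (inner ℂ u ((D.H - z • (1 : E →L[ℂ] E)) u))
    rw [h3, abs_neg] at h4
    exact (le_abs_self _).trans h4
  obtain ⟨v, hv⟩ := hco.isUnit
  have hG : Filter.Tendsto (fun δ => D.G δ z) (nhdsWithin 0 (Set.Ioi 0))
      (nhds (Ring.inverse (D.H - z • 1))) := by
    have hcont := NormedRing.inverse_continuousAt v
    rw [hv] at hcont
    exact hcont.tendsto.comp hS
  exact (hW.mul hG).mul hW

theorem exists_norm_weightedResolvent_sub_F_le : ∃ C θ δ₀ : ℝ, 0 ≤ C ∧ 0 < θ ∧ D.Small δ₀ ∧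
    ∀ z, D.Admissible z → ∀ δ ∈ Set.Ioc 0 δ₀, ‖D.weightedResolvent z - D.F δ z‖ ≤ C * δ ^ θ := by
  obtain ⟨δ₀, hδ₀⟩ := D.exists_small
  obtain ⟨K, hK, hF'⟩ := D.norm_F'_le
  have hθ : 0 < D.ε - 1 / 2 := by linarith [D.half_lt_ε]
  obtain ⟨C, hC, hmain⟩ := exists_holder_of_norm_deriv_le (E := E →L[ℂ] E)
    (R := D.κ * (2 / D.c / δ₀) * D.κ) hθ hK hδ₀.1
  refine ⟨C, D.ε - 1 / 2, δ₀, hC, hθ, hδ₀, fun z hz δ hδ => ?_⟩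
  have hsm : ∀ d ∈ Set.Ioc 0 δ₀, D.Small d := fun d hd => hδ₀.mono hd.1 hd.2
  have hκ := D.κ_pos
  have h1 := hmain (fun d => D.F d z) (fun d => D.F' d z)
    (fun d hd => D.hasDerivAt_F (hsm d hd) hz)
    (fun d hd => by
      have := hF' d z (hsm d hd) hz
      rwa [show D.ε - 1 / 2 - 1 = D.ε - 3 / 2 by ring])
    (by
      have h2 : ‖D.G δ₀ z‖ ≤ 2 / D.c / δ₀ := by
        rw [le_div_iff₀ hδ₀.1, mul_comm]; exact D.mul_norm_G_le hδ₀ hz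
      have h3 := D.norm_Wd_le hδ₀.1
      have h4 : 0 ≤ D.κ * (2 / D.c / δ₀) := by
        have := D.c_pos
        have := hδ₀.1
        positivity
      exact norm_mul₃_le.trans (by gcongr))
    δ hδ
  refine le_of_tendsto ((D.tendsto_F hz).sub_const (D.F δ z)).norm ?_
  filter_upwards [Ioc_mem_nhdsGT hδ.1] with d hd using h1 d hd

theorem norm_F_sub_le {δ : ℝ} {z z' : ℂ} (hδ : D.Small δ) (hz : D.Admissible z)
    (hz' : D.Admissible z') :
    ‖D.F δ z - D.F δ z'‖ ≤
      D.κ * (2 / D.c / δ * ((1 + 2 * D.κ ^ 2) * ‖z - z'‖) * (2 / D.c / δ)) * D.κ := by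
  have hκ := D.κ_pos
  have h0 := hδ.1
  have hW := D.norm_Wd_le h0
  have hG : ∀ z, D.Admissible z → ‖D.G δ z‖ ≤ 2 / D.c / δ := fun z hz => by
    rw [le_div_iff₀ h0, mul_comm]; exact D.mul_norm_G_le hδ hz
  have e1 : D.G δ z - D.G δ z' = D.G δ z * (D.S δ z' - D.S δ z) * D.G δ z' := by
    rw [mul_sub, sub_mul, D.G_mul_S hδ hz, mul_assoc, D.S_mul_G hδ hz', mul_one, one_mul]
  have e2 : D.F δ z - D.F δ z' = D.Wd δ * (D.G δ z * (D.S δ z' - D.S δ z) * D.G δ z') * D.Wd δ := by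
    rw [← e1, F, F]; noncomm_ring
  have hS : ‖D.S δ z' - D.S δ z‖ ≤ (1 + 2 * D.κ ^ 2) * ‖z - z'‖ := by
    have hre : |z.re - z'.re| ≤ ‖z - z'‖ := by
      rw [← Complex.sub_re]; exact Complex.abs_re_le_norm _
    set X := D.H - (z.re : ℂ) • (1 : E →L[ℂ] E) with hX
    set X' := D.H - (z'.re : ℂ) • (1 : E →L[ℂ] E) with hX'
    have n1 : ‖(1 : E →L[ℂ] E)‖ ≤ 1 := ContinuousLinearMap.norm_id_le
    have hXX : ‖X - X'‖ ≤ ‖z - z'‖ := by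
      have : X - X' = ((z'.re - z.re : ℝ) : ℂ) • (1 : E →L[ℂ] E) := by
        rw [hX, hX', Complex.ofReal_sub, sub_smul]; abel
      rw [this, norm_smul, Complex.norm_real, Real.norm_eq_abs, abs_sub_comm]
      calc _ ≤ ‖z - z'‖ * 1 := by gcongr
        _ = _ := mul_one _
    have hXn := D.norm_H_sub_le _ hz.1
    have hXn' := D.norm_H_sub_le _ hz'.1
    rw [← hX] at hXn
    rw [← hX'] at hXn'
    have e3 : D.S δ z' - D.S δ z = (z - z') • (1 : E →L[ℂ] E)
        + (Complex.I * δ) • ((D.C₀ : ℂ) • (X * (X - X') + (X - X') * X')) := by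
      have : D.M δ z.re - D.M δ z'.re = (D.C₀ : ℂ) • (X * (X - X') + (X - X') * X') := by
        rw [M, M, ← hX, ← hX', add_sub_add_left_eq_sub, ← smul_sub]
        congr 1
        noncomm_ring
      rw [← this, S, S, sub_smul, smul_sub]
      abel
    rw [e3]
    have n2 : ‖X * (X - X') + (X - X') * X'‖ ≤ D.κ * ‖z - z'‖ + ‖z - z'‖ * D.κ :=
      (norm_add_le _ _).trans (add_le_add ((norm_mul_le _ _).trans (by gcongr))
        ((norm_mul_le _ _).trans (by gcongr)))
    have n3 : ‖(Complex.I * δ) • ((D.C₀ : ℂ) • (X * (X - X') + (X - X') * X'))‖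
        ≤ 1 * (D.κ * (D.κ * ‖z - z'‖ + ‖z - z'‖ * D.κ)) := by
      rw [norm_smul, norm_mul, Complex.norm_I, one_mul, Complex.norm_real,
        Real.norm_of_nonneg h0.le, norm_smul, Complex.norm_real, Real.norm_of_nonneg D.C₀_nonneg]
      gcongr
      · have := D.C₀_nonneg
        positivity
      · exact hδ.2.1
      · exact D.C₀_le
    have n4 : ‖(z - z') • (1 : E →L[ℂ] E)‖ ≤ ‖z - z'‖ * 1 := by
      rw [norm_smul]; gcongr
    refine (norm_add_le _ _).trans ((add_le_add n4 n3).trans (le_of_eq ?_))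
    ring
  have hc := D.c_pos
  rw [e2]
  refine norm_mul₃_le.trans ?_
  have h5 : ‖D.G δ z * (D.S δ z' - D.S δ z) * D.G δ z'‖
      ≤ 2 / D.c / δ * ((1 + 2 * D.κ ^ 2) * ‖z - z'‖) * (2 / D.c / δ) :=
    norm_mul₃_le.trans (by gcongr; exacts [hG z hz, hG z' hz'])
  gcongr

/-- The limiting absorption principle at `lam₀`. -/
theorem exists_tendsto_weightedResolvent : ∃ y : E →L[ℂ] E,
    Filter.Tendsto D.weightedResolvent (nhdsWithin (D.lam₀ : ℂ) {z | 0 < z.im}) (nhds y) := by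
  have hne : (nhdsWithin (D.lam₀ : ℂ) {z | 0 < z.im}).NeBot := by
    rw [← mem_closure_iff_nhdsWithin_neBot, Complex.closure_setOfPred_lt_im]
    simp
  rw [← cauchy_map_iff_exists_tendsto, Metric.cauchy_iff]
  refine ⟨hne.map _, fun r hr => ?_⟩
  obtain ⟨C, θ, δ₀, hC, hθ, hδ₀, hmain⟩ := D.exists_norm_weightedResolvent_sub_F_le
  obtain ⟨δ, hδC, hδ⟩ : ∃ δ : ℝ, C * δ ^ θ < r / 4 ∧ δ ∈ Set.Ioc 0 δ₀ := by
    have h1 : Filter.Tendsto (fun δ : ℝ => C * δ ^ θ) (nhdsWithin 0 (Set.Ioi 0)) (nhds 0) := by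
      have := ((Real.continuousAt_rpow_const 0 θ (Or.inr hθ.le)).const_mul C).tendsto
      rw [Real.zero_rpow hθ.ne', mul_zero] at this
      exact this.mono_left nhdsWithin_le_nhds
    exact ((h1.eventually_lt_const (by positivity)).and (Ioc_mem_nhdsGT hδ₀.1)).exists
  have hsm := hδ₀.mono hδ.1 hδ.2
  have hκ := D.κ_pos
  have hc := D.c_pos
  have h0 := hδ.1
  set L := D.κ * (2 / D.c / δ * (1 + 2 * D.κ ^ 2) * (2 / D.c / δ)) * D.κ with hL
  have hL0 : 0 < L := by positivity
  set s := min (min D.ρ 1) (r / 4 / L) with hs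
  have hs0 : 0 < s := by
    have := D.ρ_pos
    positivity
  have hadm : ∀ z ∈ Metric.ball (D.lam₀ : ℂ) (s / 2) ∩ {z | 0 < z.im}, D.Admissible z := by
    rintro z ⟨hz1, hz2⟩
    rw [Metric.mem_ball, Complex.dist_eq] at hz1
    have h3 := Complex.abs_re_le_norm (z - D.lam₀)
    have h4 := Complex.abs_im_le_norm (z - D.lam₀)
    simp only [Complex.sub_re, Complex.ofReal_re, Complex.sub_im, Complex.ofReal_im, sub_zero]
      at h3 h4
    have h5 : s ≤ D.ρ := (min_le_left _ _).trans (min_le_left _ _)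
    have h6 : s ≤ 1 := (min_le_left _ _).trans (min_le_right _ _)
    exact ⟨by linarith, hz2, by linarith [le_abs_self z.im]⟩
  refine ⟨D.weightedResolvent '' (Metric.ball (D.lam₀ : ℂ) (s / 2) ∩ {z | 0 < z.im}),
    Filter.image_mem_map (Filter.inter_mem
      (mem_nhdsWithin_of_mem_nhds (Metric.ball_mem_nhds _ (by positivity)))
      self_mem_nhdsWithin), ?_⟩
  rintro _ ⟨z, hz, rfl⟩ _ ⟨z', hz', rfl⟩
  have a1 := hmain z (hadm z hz) δ hδ
  have a2 := hmain z' (hadm z' hz') δ hδ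
  have a3 := D.norm_F_sub_le hsm (hadm z hz) (hadm z' hz')
  have a4 : ‖z - z'‖ < s := by
    have b1 := Metric.mem_ball.1 hz.1
    have b2 := Metric.mem_ball.1 hz'.1
    rw [← Complex.dist_eq]
    have := dist_triangle_right z z' (D.lam₀ : ℂ)
    linarith
  have a5 : L * ‖z - z'‖ ≤ r / 4 := by
    have : ‖z - z'‖ ≤ r / 4 / L := a4.le.trans (min_le_right _ _)
    rwa [le_div_iff₀ hL0, mul_comm] at this
  have a6 : D.κ * (2 / D.c / δ * ((1 + 2 * D.κ ^ 2) * ‖z - z'‖) * (2 / D.c / δ)) * D.κ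
      = L * ‖z - z'‖ := by rw [hL]; ring
  rw [a6] at a3
  rw [dist_eq_norm]
  have e : D.weightedResolvent z - D.weightedResolvent z' =
      (D.weightedResolvent z - D.F δ z) + (D.F δ z - D.F δ z')
        - (D.weightedResolvent z' - D.F δ z') := by abel
  rw [e]
  have t1 := norm_sub_le ((D.weightedResolvent z - D.F δ z) + (D.F δ z - D.F δ z'))
    (D.weightedResolvent z' - D.F δ z')
  have t2 := norm_add_le (D.weightedResolvent z - D.F δ z) (D.F δ z - D.F δ z')
  linarith

end ConjugateData

end Mourre

section LatticeOperators

theorem hasSum_norm_sq (f : H2) : HasSum (fun n => ‖f n‖ ^ 2) (‖f‖ ^ 2) := by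
  simpa using lp.hasSum_norm (p := 2) (by norm_num) f

theorem memℓp_two_of_summable {a : ℤ × ℤ → ℂ} (h : Summable fun n => ‖a n‖ ^ 2) :
    Memℓp a 2 :=
  memℓp_gen (by simpa using h)

theorem norm_le_of_forall_norm_apply_le {f g : H2} {C : ℝ} (hC : 0 ≤ C)
    (h : ∀ n, ‖g n‖ ≤ C * ‖f n‖) : ‖g‖ ≤ C * ‖f‖ := by
  refine (sq_le_sq₀ (norm_nonneg _) (by positivity)).1 ?_
  rw [mul_pow]
  refine hasSum_le (fun n => ?_) (hasSum_norm_sq g) ((hasSum_norm_sq f).mul_left (C ^ 2))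
  rw [← mul_pow]
  exact pow_le_pow_left₀ (norm_nonneg _) (h n) 2

/-- Boundedness of a function on the lattice. -/
def BoundedFun (a : ℤ × ℤ → ℂ) : Prop := ∃ C : ℝ, ∀ n, ‖a n‖ ≤ C

theorem BoundedFun.mul {a b : ℤ × ℤ → ℂ} (ha : BoundedFun a) (hb : BoundedFun b) :
    BoundedFun (a * b) := by
  obtain ⟨C, hC⟩ := ha
  obtain ⟨C', hC'⟩ := hb
  refine ⟨C * C', fun n => ?_⟩
  rw [Pi.mul_apply, norm_mul]
  exact mul_le_mul (hC n) (hC' n) (norm_nonneg _) ((norm_nonneg _).trans (hC n))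

theorem BoundedFun.sub {a b : ℤ × ℤ → ℂ} (ha : BoundedFun a) (hb : BoundedFun b) :
    BoundedFun (a - b) := by
  obtain ⟨C, hC⟩ := ha
  obtain ⟨C', hC'⟩ := hb
  exact ⟨C + C', fun n => (norm_sub_le _ _).trans (add_le_add (hC n) (hC' n))⟩

theorem BoundedFun.comp {a : ℤ × ℤ → ℂ} (ha : BoundedFun a) (s : ℤ × ℤ → ℤ × ℤ) :
    BoundedFun fun n => a (s n) :=
  ⟨ha.choose, fun n => ha.choose_spec (s n)⟩

open scoped Classical in
/-- Multiplication by a bounded function (and zero if the function is unbounded). -/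
def mulOp (a : ℤ × ℤ → ℂ) : H2 →L[ℂ] H2 :=
  if h : BoundedFun a then
    LinearMap.mkContinuous
      { toFun := fun f => ⟨fun n => a n * f n, by
          obtain ⟨C, hC⟩ := h
          refine memℓp_two_of_summable (.of_nonneg_of_le (fun n => by positivity) (fun n => ?_)
            ((hasSum_norm_sq f).summable.mul_left (C ^ 2)))
          rw [norm_mul, mul_pow]
          gcongr
          exact hC n⟩
        map_add' := fun f g => lp.ext (funext fun n => mul_add _ _ _)
        map_smul' := fun c f => lp.ext (funext fun n => mul_left_comm _ _ _) }
      h.choose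
      (fun f => norm_le_of_forall_norm_apply_le ((norm_nonneg (a 0)).trans (h.choose_spec 0))
        (fun n => by
          change ‖a n * f n‖ ≤ _
          rw [norm_mul]
          gcongr
          exact h.choose_spec n))
  else 0

theorem mulOp_apply {a : ℤ × ℤ → ℂ} (h : BoundedFun a) (f : H2) (n : ℤ × ℤ) :
    mulOp a f n = a n * f n := by
  rw [mulOp, dif_pos h]
  rfl

theorem norm_mulOp_le {a : ℤ × ℤ → ℂ} {C : ℝ} (h : ∀ n, ‖a n‖ ≤ C) : ‖mulOp a‖ ≤ C := by
  have hC : 0 ≤ C := (norm_nonneg _).trans (h 0)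
  refine ContinuousLinearMap.opNorm_le_bound _ hC fun f => ?_
  refine norm_le_of_forall_norm_apply_le hC fun n => ?_
  rw [mulOp_apply ⟨C, h⟩, norm_mul]
  gcongr
  exact h n

theorem mulOp_mul {a b : ℤ × ℤ → ℂ} (ha : BoundedFun a) (hb : BoundedFun b) :
    mulOp (a * b) = mulOp a * mulOp b := by
  ext f n
  rw [mul_apply_eq_comp, mulOp_apply ha, mulOp_apply hb, mulOp_apply (ha.mul hb), Pi.mul_apply,
    mul_assoc]

theorem mulOp_sub {a b : ℤ × ℤ → ℂ} (ha : BoundedFun a) (hb : BoundedFun b) :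
    mulOp (a - b) = mulOp a - mulOp b := by
  ext f n
  rw [sub_apply, lp.coeFn_sub, Pi.sub_apply, mulOp_apply ha, mulOp_apply hb,
    mulOp_apply (ha.sub hb), Pi.sub_apply, sub_mul]

theorem mulOp_const (c : ℂ) : mulOp (fun _ => c) = c • 1 := by
  ext f n
  rw [mulOp_apply ⟨‖c‖, fun _ => le_rfl⟩]
  rfl

theorem commute_mulOp (a b : ℤ × ℤ → ℂ) : Commute (mulOp a) (mulOp b) := by
  by_cases ha : BoundedFun a
  · by_cases hb : BoundedFun b
    · rw [commute_iff_eq, ← mulOp_mul ha hb, ← mulOp_mul hb ha, mul_comm]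
    · rw [mulOp.eq_1 b, dif_neg hb]
      exact Commute.zero_right _
  · rw [mulOp.eq_1 a, dif_neg ha]
    exact Commute.zero_left _

theorem star_mulOp (a : ℤ × ℤ → ℂ) : star (mulOp a) = mulOp (star a) := by
  by_cases ha : BoundedFun a
  · have hb : BoundedFun (star a) := ⟨ha.choose, fun n => by
      rw [Pi.star_apply, norm_star]; exact ha.choose_spec n⟩
    rw [ContinuousLinearMap.star_eq_adjoint, eq_comm, ContinuousLinearMap.eq_adjoint_iff]
    intro f g
    rw [lp.inner_eq_tsum, lp.inner_eq_tsum]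
    refine tsum_congr fun n => ?_
    rw [mulOp_apply ha, mulOp_apply hb]
    simp only [Pi.star_apply, RCLike.inner_apply, map_mul, starRingEnd_apply, star_star]
    ring
  · have hb : ¬ BoundedFun (star a) := fun h => ha ⟨h.choose, fun n => by
      have := h.choose_spec n; rwa [Pi.star_apply, norm_star] at this⟩
    rw [mulOp, mulOp, dif_neg ha, dif_neg hb, star_zero]

theorem isSelfAdjoint_mulOp_ofReal (a : ℤ × ℤ → ℝ) :
    IsSelfAdjoint (mulOp fun n => (a n : ℂ)) := by
  rw [isSelfAdjoint_iff, star_mulOp]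
  congr 1
  ext n
  simp

/-- Pointwise convergence of uniformly bounded functions gives strong convergence of the
multiplication operators. -/
theorem tendsto_mulOp_apply {a : ℕ → ℤ × ℤ → ℂ} {b : ℤ × ℤ → ℂ} {C : ℝ}
    (ha : ∀ L n, ‖a L n‖ ≤ C) (hab : ∀ n, Tendsto (fun L => a L n) atTop (nhds (b n)))
    (f : H2) : Tendsto (fun L => mulOp (a L) f) atTop (nhds (mulOp b f)) := by
  have hb : ∀ n, ‖b n‖ ≤ C := fun n => le_of_tendsto' (hab n).norm fun L => ha L n
  rw [tendsto_iff_norm_sub_tendsto_zero]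
  have key : Tendsto (fun L => ∑' n, ‖(mulOp (a L) f - mulOp b f) n‖ ^ 2) atTop
      (nhds (∑' _ : ℤ × ℤ, (0 : ℝ))) := by
    refine tendsto_tsum_of_dominated_convergence (bound := fun n => (2 * C) ^ 2 * ‖f n‖ ^ 2)
      ((hasSum_norm_sq f).summable.mul_left _) (fun n => ?_) (.of_forall fun L n => ?_)
    · have h1 : Tendsto (fun L => ‖(a L n - b n) * f n‖ ^ 2) atTop (nhds (‖(0 : ℂ) * f n‖ ^ 2)) :=
        (((tendsto_sub_nhds_zero_iff.2 (hab n)).mul_const _).norm.pow 2)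
      simpa [mulOp_apply ⟨C, ha _⟩, mulOp_apply ⟨C, hb⟩, sub_mul] using h1
    · rw [lp.coeFn_sub, Pi.sub_apply, mulOp_apply ⟨C, ha _⟩, mulOp_apply ⟨C, hb⟩, ← sub_mul,
        norm_mul, mul_pow, Real.norm_of_nonneg (by positivity)]
      gcongr
      exact (norm_sub_le _ _).trans (by linarith [ha L n, hb n])
  simp only [(hasSum_norm_sq _).tsum_eq, tsum_zero] at key
  have := key.sqrt
  simpa using this

theorem hasSum_norm_sq_add (f : H2) (e : ℤ × ℤ) :
    HasSum (fun n => ‖f (n + e)‖ ^ 2) (‖f‖ ^ 2) :=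
  (Equiv.hasSum_iff (f := fun n => ‖f n‖ ^ 2) (Equiv.addRight e)).2 (hasSum_norm_sq f)

/-- Translation on the lattice. -/
def shift (e : ℤ × ℤ) : H2 →L[ℂ] H2 :=
  LinearMap.mkContinuous
    { toFun := fun f => ⟨fun n => f (n + e), 
        memℓp_two_of_summable (hasSum_norm_sq_add f e).summable⟩
      map_add' := fun f g => rfl
      map_smul' := fun c f => rfl }
    1
    (fun f => by
      rw [one_mul]
      refine (sq_le_sq₀ (norm_nonneg _) (norm_nonneg _)).1 (le_of_eq ?_)
      exact HasSum.unique (hasSum_norm_sq _) (hasSum_norm_sq_add f e))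

@[simp]
theorem shift_apply (e : ℤ × ℤ) (f : H2) (n : ℤ × ℤ) : shift e f n = f (n + e) := rfl

theorem norm_shift_le (e : ℤ × ℤ) : ‖shift e‖ ≤ 1 :=
  LinearMap.mkContinuous_norm_le _ zero_le_one _

theorem shift_zero : shift 0 = 1 := by
  ext f n
  simp

theorem shift_add (d e : ℤ × ℤ) : shift (d + e) = shift d * shift e := by
  ext f n
  simp [mul_apply_eq_comp, add_assoc]

theorem star_shift (e : ℤ × ℤ) : star (shift e) = shift (-e) := by
  rw [ContinuousLinearMap.star_eq_adjoint, eq_comm, ContinuousLinearMap.eq_adjoint_iff]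
  intro f g
  rw [lp.inner_eq_tsum, lp.inner_eq_tsum, ← (Equiv.addRight e).tsum_eq]
  simp

theorem shift_mul_mulOp (e : ℤ × ℤ) (a : ℤ × ℤ → ℂ) :
    shift e * mulOp a = mulOp (fun n => a (n + e)) * shift e := by
  by_cases ha : BoundedFun a
  · ext f n
    rw [mul_apply_eq_comp, mul_apply_eq_comp, shift_apply, mulOp_apply ha,
      mulOp_apply (ha.comp _), shift_apply]
  · have hb : ¬ BoundedFun (fun n => a (n + e)) := fun h => ha ⟨h.choose, fun n => by
      simpa using h.choose_spec (n - e)⟩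
    rw [mulOp, mulOp, dif_neg ha, dif_neg hb, mul_zero, zero_mul]

/-- The representation of the group algebra of the lattice by translations. -/
def shiftAlg : AddMonoidAlgebra ℂ (ℤ × ℤ) →ₐ[ℂ] (H2 →L[ℂ] H2) :=
  AddMonoidAlgebra.lift ℂ (H2 →L[ℂ] H2) (ℤ × ℤ)
    { toFun := fun e => shift e.toAdd
      map_one' := shift_zero
      map_mul' := fun d e => shift_add d.toAdd e.toAdd }

@[simp]
theorem shiftAlg_single (e : ℤ × ℤ) (c : ℂ) :
    shiftAlg (AddMonoidAlgebra.single e c) = c • shift e := by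
  simp [shiftAlg]

end LatticeOperators

section FreeOperators

/-- The nearest neighbours of the origin in the triangular lattice. -/
def nbrs : Finset (ℤ × ℤ) := {(1, 0), (-1, 0), (0, 1), (0, -1), (1, -1), (-1, 1)}

theorem sum_nbrs {M : Type*} [AddCommMonoid M] (f : ℤ × ℤ → M) :
    ∑ e ∈ nbrs, f e = f (1, 0) + (f (-1, 0) + (f (0, 1) + (f (0, -1) + (f (1, -1) +
      f (-1, 1))))) := by
  simp only [nbrs]
  repeat rw [Finset.sum_insert (by decide)]
  rw [Finset.sum_singleton]

theorem sum_nbrs_neg {M : Type*} [AddCommMonoid M] (f : ℤ × ℤ → M) :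
    ∑ e ∈ nbrs, f (-e) = ∑ e ∈ nbrs, f e :=
  Finset.sum_nbij' (fun e => -e) (fun e => -e) (by decide) (by decide) (by simp) (by simp)
    (by simp)

theorem abs_le_one_of_mem_nbrs : ∀ e ∈ nbrs, |e.1| ≤ 1 ∧ |e.2| ≤ 1 := by decide

/-- The Laplacian of the triangular lattice as an operator on `ℓ²(ℤ²)`. -/
def freeLap : H2 →L[ℂ] H2 := (1 / 6 : ℂ) • ∑ e ∈ nbrs, shift e

/-- The velocity operator in the first lattice direction. -/
def vel₁ : H2 →L[ℂ] H2 := (Complex.I / 6) • ∑ e ∈ nbrs, (e.1 : ℂ) • shift e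

/-- The velocity operator in the second lattice direction. -/
def vel₂ : H2 →L[ℂ] H2 := (Complex.I / 6) • ∑ e ∈ nbrs, (e.2 : ℂ) • shift e

/-- The commutator of the free Laplacian with the generator of dilations. -/
def freeComm : H2 →L[ℂ] H2 := vel₁ * vel₁ + vel₂ * vel₂

theorem isSelfAdjoint_freeLap : IsSelfAdjoint freeLap := by
  rw [isSelfAdjoint_iff, freeLap, star_smul, star_sum]
  simp only [star_shift]
  rw [sum_nbrs_neg]
  simp

theorem isSelfAdjoint_vel₁ : IsSelfAdjoint vel₁ := by
  rw [isSelfAdjoint_iff, vel₁, star_smul, star_sum, ← sum_nbrs_neg, Finset.smul_sum,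
    Finset.smul_sum]
  refine Finset.sum_congr rfl fun e _ => ?_
  simp [star_shift, smul_smul, neg_div]

theorem isSelfAdjoint_vel₂ : IsSelfAdjoint vel₂ := by
  rw [isSelfAdjoint_iff, vel₂, star_smul, star_sum, ← sum_nbrs_neg, Finset.smul_sum,
    Finset.smul_sum]
  refine Finset.sum_congr rfl fun e _ => ?_
  simp [star_shift, smul_smul, neg_div]

theorem isSelfAdjoint_freeComm : IsSelfAdjoint freeComm := by
  have h1 := isSelfAdjoint_vel₁.star_eq
  have h2 := isSelfAdjoint_vel₂.star_eq
  rw [isSelfAdjoint_iff, freeComm, star_add, star_mul, star_mul, h1, h2]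

/-- The polynomial whose roots are the critical values of the symbol of the Laplacian lies in the
ideal generated by the derivatives of the symbol. -/
theorem critical_polynomial_eq {R : Type*} [CommRing R] {x x' y y' : R} (hx : x * x' = 1)
    (hy : y * y' = 1) :
    (x + x' + y + y' + x * y' + x' * y - 6) * (x + x' + y + y' + x * y' + x' * y + 2) *
        (x + x' + y + y' + x * y' + x' * y + 3) =
      (-x' ^ 2 - 8 * x' ^ 2 * y + 5 * x' ^ 2 * y ^ 2 + 3 * x' * y' - 13 * x' - 8 * x' * y
        + 8 * x' * y ^ 2 + 2 * y' ^ 2 + 3 * y' - 11 + 3 * y + 3 * y ^ 2 + 3 * x * y' ^ 2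
        + 2 * x * y' + 2 * x + 3 * x * y + x ^ 2 * y' ^ 2 + 2 * x ^ 2 * y' + x ^ 2) *
          (x - x' + x * y' - x' * y) +
      (-6 * x' ^ 2 + 6 * x' ^ 2 * y ^ 2 - 5 * x' * y' - 5 * x' + 5 * x' * y + 5 * x' * y ^ 2
        - y' ^ 2 + y ^ 2) * (y - y' - x * y' + x' * y) := by
  grind

theorem exists_critical_polynomial_eq : ∃ P₁ P₂ : H2 →L[ℂ] H2,
    (freeLap - (1 : ℂ) • 1) * (freeLap - (-1 / 3 : ℂ) • 1) * (freeLap - (-1 / 2 : ℂ) • 1) =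
      P₁ * vel₁ + P₂ * vel₂ := by
  let x : AddMonoidAlgebra ℂ (ℤ × ℤ) := .single (1, 0) 1
  let x' : AddMonoidAlgebra ℂ (ℤ × ℤ) := .single (-1, 0) 1
  let y : AddMonoidAlgebra ℂ (ℤ × ℤ) := .single (0, 1) 1
  let y' : AddMonoidAlgebra ℂ (ℤ × ℤ) := .single (0, -1) 1
  have hx : x * x' = 1 := by
    simp [x, x', AddMonoidAlgebra.single_mul_single, AddMonoidAlgebra.one_def]
    rfl
  have hy : y * y' = 1 := by
    simp [y, y', AddMonoidAlgebra.single_mul_single, AddMonoidAlgebra.one_def]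
    rfl
  have key := congrArg shiftAlg (critical_polynomial_eq hx hy)
  set p₁ := -x' ^ 2 - 8 * x' ^ 2 * y + 5 * x' ^ 2 * y ^ 2 + 3 * x' * y' - 13 * x' - 8 * x' * y
        + 8 * x' * y ^ 2 + 2 * y' ^ 2 + 3 * y' - 11 + 3 * y + 3 * y ^ 2 + 3 * x * y' ^ 2
        + 2 * x * y' + 2 * x + 3 * x * y + x ^ 2 * y' ^ 2 + 2 * x ^ 2 * y' + x ^ 2
  set p₂ := -6 * x' ^ 2 + 6 * x' ^ 2 * y ^ 2 - 5 * x' * y' - 5 * x' + 5 * x' * y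
        + 5 * x' * y ^ 2 - y' ^ 2 + y ^ 2
  have hxy : x * y' = .single (1, -1) 1 := by simp [x, y', AddMonoidAlgebra.single_mul_single]
  have hxy' : x' * y = .single (-1, 1) 1 := by simp [x', y, AddMonoidAlgebra.single_mul_single]
  rw [hxy, hxy'] at key
  have e1 : shiftAlg (x + x' + y + y' + .single (1, -1) 1 + .single (-1, 1) 1) =
      (6 : ℂ) • freeLap := by
    simp only [map_add, x, x', y, y', shiftAlg_single, freeLap, sum_nbrs, smul_smul]
    norm_num
    abel
  have e2 : shiftAlg (x - x' + .single (1, -1) 1 - .single (-1, 1) 1) =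
      (-6 * Complex.I) • vel₁ := by
    simp only [map_add, map_sub, x, x', shiftAlg_single, vel₁, sum_nbrs, smul_smul]
    have : -6 * Complex.I * (Complex.I / 6) = 1 := by
      linear_combination -Complex.I_mul_I
    rw [this]
    norm_num
    abel
  have e3 : shiftAlg (y - y' - .single (1, -1) 1 + .single (-1, 1) 1) =
      (-6 * Complex.I) • vel₂ := by
    simp only [map_add, map_sub, y, y', shiftAlg_single, vel₂, sum_nbrs, smul_smul]
    have : -6 * Complex.I * (Complex.I / 6) = 1 := by
      linear_combination -Complex.I_mul_I
    rw [this]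
    norm_num
    abel
  rw [map_add, map_mul, map_mul, map_mul, map_mul, map_sub, map_add shiftAlg _ 2,
    map_add shiftAlg _ 3, e1, e2, e3] at key
  have c6 : shiftAlg 6 = (6 : ℂ) • (1 : H2 →L[ℂ] H2) := by
    rw [map_ofNat, ← Algebra.algebraMap_eq_smul_one, map_ofNat]
  have c2 : shiftAlg 2 = (2 : ℂ) • (1 : H2 →L[ℂ] H2) := by
    rw [map_ofNat, ← Algebra.algebraMap_eq_smul_one, map_ofNat]
  have c3 : shiftAlg 3 = (3 : ℂ) • (1 : H2 →L[ℂ] H2) := by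
    rw [map_ofNat, ← Algebra.algebraMap_eq_smul_one, map_ofNat]
  rw [c6, c2, c3] at key
  have d6 : (6 : ℂ) • freeLap - (6 : ℂ) • 1 = (6 : ℂ) • (freeLap - (1 : ℂ) • 1) := by
    rw [smul_sub, smul_smul, mul_one]
  have d2 : (6 : ℂ) • freeLap + (2 : ℂ) • 1 = (6 : ℂ) • (freeLap - (-1 / 3 : ℂ) • 1) := by
    rw [smul_sub, smul_smul]; norm_num
  have d3 : (6 : ℂ) • freeLap + (3 : ℂ) • 1 = (6 : ℂ) • (freeLap - (-1 / 2 : ℂ) • 1) := by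
    rw [smul_sub, smul_smul]; norm_num
  rw [d6, d2, d3] at key
  simp only [smul_mul_assoc, mul_smul_comm, smul_smul] at key
  refine ⟨((6 * (6 * 6) : ℂ)⁻¹ * (-6 * Complex.I)) • shiftAlg p₁,
    ((6 * (6 * 6) : ℂ)⁻¹ * (-6 * Complex.I)) • shiftAlg p₂, ?_⟩
  rw [smul_mul_assoc, smul_mul_assoc, mul_smul _ _ (shiftAlg p₁ * vel₁),
    mul_smul _ _ (shiftAlg p₂ * vel₂), ← smul_add, ← key, smul_smul]
  norm_num

/-- Away from the critical values, the free Laplacian satisfies a Mourre estimate. -/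
theorem exists_norm_le_vel {lam : ℝ} (h1 : lam ≠ 1) (h2 : lam ≠ -(1 / 3)) (h3 : lam ≠ -(1 / 2)) :
    ∃ K : ℝ, 0 ≤ K ∧ ∀ f : H2,
      ‖f‖ ≤ K * (‖vel₁ f‖ + ‖vel₂ f‖ + ‖(freeLap - (lam : ℂ) • 1) f‖) := by
  obtain ⟨P₁, P₂, hP⟩ := exists_critical_polynomial_eq
  set X := freeLap - (lam : ℂ) • 1 with hX
  have e : ∀ t : ℂ, freeLap - t • 1 = X + ((lam : ℂ) - t) • 1 := fun t => by
    rw [hX, sub_smul]; abel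
  set u : ℂ := lam - 1
  set v : ℂ := lam - (-1 / 3)
  set w : ℂ := lam - (-1 / 2)
  set R : H2 →L[ℂ] H2 := X * X + (u + v + w) • X + (u * v + u * w + v * w) • 1 with hR
  have huvw : u * v * w ≠ 0 := by
    refine mul_ne_zero (mul_ne_zero ?_ ?_) ?_ <;> rw [sub_ne_zero] <;>
      intro h <;> have := congrArg Complex.re h <;> simp at this
    · exact h1 this
    · exact h2 (by rw [this]; norm_num)
    · exact h3 (by rw [this]; norm_num)
  have key : (u * v * w) • (1 : H2 →L[ℂ] H2) = P₁ * vel₁ + P₂ * vel₂ - R * X := by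
    rw [← hP, e, e, e, hR]
    simp only [add_mul, mul_add, smul_mul_assoc, mul_smul_comm, one_mul, mul_one, smul_add,
      smul_smul, mul_assoc]
    module
  refine ⟨‖u * v * w‖⁻¹ * max ‖P₁‖ (max ‖P₂‖ ‖R‖), by positivity, fun f => ?_⟩
  rw [mul_assoc, ← div_eq_inv_mul, le_div_iff₀ (norm_pos_iff.2 huvw), mul_comm, ← norm_smul]
  have := congrArg (fun Z : H2 →L[ℂ] H2 => Z f) key
  simp only [smul_apply, one_apply_eq_self, sub_apply, add_apply, mul_apply_eq_comp] at this
  rw [this]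
  set m := max ‖P₁‖ (max ‖P₂‖ ‖R‖)
  calc _ ≤ ‖P₁ (vel₁ f)‖ + ‖P₂ (vel₂ f)‖ + ‖R (X f)‖ :=
        (norm_sub_le _ _).trans (by gcongr; exact norm_add_le _ _)
    _ ≤ m * ‖vel₁ f‖ + m * ‖vel₂ f‖ + m * ‖X f‖ :=
        add_le_add (add_le_add (P₁.le_of_opNorm_le (le_max_left _ _) _)
          (P₂.le_of_opNorm_le ((le_max_left _ _).trans (le_max_right _ _)) _))
          (R.le_of_opNorm_le ((le_max_right _ _).trans (le_max_right _ _)) _)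
    _ = _ := by ring

theorem inner_freeComm_eq (f : H2) :
    (inner ℂ f (freeComm f)).re = ‖vel₁ f‖ ^ 2 + ‖vel₂ f‖ ^ 2 := by
  have h1 : ∀ {Z : H2 →L[ℂ] H2}, IsSelfAdjoint Z → (inner ℂ f (Z (Z f))).re = ‖Z f‖ ^ 2 := by
    intro Z hZ
    rw [← ContinuousLinearMap.adjoint_inner_left, ← ContinuousLinearMap.star_eq_adjoint,
      hZ.star_eq, ← inner_self_eq_norm_sq (𝕜 := ℂ)]
    rfl
  rw [freeComm, add_apply, inner_add_right, Complex.add_re, mul_apply_eq_comp, mul_apply_eq_comp,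
    h1 isSelfAdjoint_vel₁, h1 isSelfAdjoint_vel₂]

theorem exists_freeComm_positivity {lam : ℝ} (h1 : lam ≠ 1) (h2 : lam ≠ -(1 / 3))
    (h3 : lam ≠ -(1 / 2)) : ∃ c : ℝ, 0 < c ∧ ∀ f : H2,
      c * ‖f‖ ^ 2 ≤ (inner ℂ f (freeComm f)).re + ‖(freeLap - (lam : ℂ) • 1) f‖ ^ 2 := by
  obtain ⟨K, hK, h⟩ := exists_norm_le_vel h1 h2 h3
  refine ⟨1 / (3 * (K ^ 2 + 1)), by positivity, fun f => ?_⟩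
  rw [inner_freeComm_eq, div_mul_eq_mul_div, one_mul, div_le_iff₀ (by positivity)]
  have h4 := pow_le_pow_left₀ (norm_nonneg _) (h f) 2
  generalize ‖vel₁ f‖ = p at *
  generalize ‖vel₂ f‖ = q at *
  generalize ‖(freeLap - (lam : ℂ) • 1) f‖ = r at *
  have h5 : (p + q + r) ^ 2 ≤ 3 * (p ^ 2 + q ^ 2 + r ^ 2) := by
    nlinarith [sq_nonneg (p - q), sq_nonneg (p - r), sq_nonneg (q - r)]
  calc _ ≤ _ := h4
    _ = K ^ 2 * (p + q + r) ^ 2 := by ring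
    _ ≤ (K ^ 2 + 1) * (3 * (p ^ 2 + q ^ 2 + r ^ 2)) := by gcongr; linarith
    _ = _ := by ring

end FreeOperators

section RelativeCompactness

variable {E : Type*} [NormedAddCommGroup E] [InnerProductSpace ℂ E]

/-- `K` is infinitesimally small relative to `X`, up to a small multiple of the norm. -/
def Negligible (X K : E →L[ℂ] E) : Prop :=
  ∀ r : ℝ, 0 < r → ∃ C : ℝ, 0 ≤ C ∧ ∀ f, ‖K f‖ ≤ r * ‖f‖ + C * ‖X f‖

variable {X K K' : E →L[ℂ] E}

theorem Negligible.add (h : Negligible X K) (h' : Negligible X K') : Negligible X (K + K') := by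
  intro r hr
  obtain ⟨C, hC, hK⟩ := h (r / 2) (by positivity)
  obtain ⟨C', hC', hK'⟩ := h' (r / 2) (by positivity)
  refine ⟨C + C', by positivity, fun f => (norm_add_le _ _).trans ?_⟩
  exact (add_le_add (hK f) (hK' f)).trans (le_of_eq (by ring))

theorem Negligible.mul_left (h : Negligible X K) (Z : E →L[ℂ] E) : Negligible X (Z * K) := by
  intro r hr
  obtain ⟨C, hC, hK⟩ := h (r / (‖Z‖ + 1)) (by positivity)
  refine ⟨(‖Z‖ + 1) * C, by positivity, fun f => ?_⟩
  calc ‖Z (K f)‖ ≤ ‖Z‖ * ‖K f‖ := Z.le_opNorm _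
    _ ≤ (‖Z‖ + 1) * (r / (‖Z‖ + 1) * ‖f‖ + C * ‖X f‖) := by
      gcongr
      · linarith
      · exact hK f
    _ = _ := by field_simp

/-- If `X` is self-adjoint and injective, its range is dense, so that every vector functional is
infinitesimally small relative to `X`. -/
theorem exists_norm_inner_le [CompleteSpace E] (hX : IsSelfAdjoint X)
    (hinj : ∀ f, X f = 0 → f = 0) (v : E) {r : ℝ}
    (hr : 0 < r) : ∃ C : ℝ, 0 ≤ C ∧ ∀ f, ‖inner ℂ v f‖ ≤ r * ‖f‖ + C * ‖X f‖ := by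
  have hd : Dense (X.range : Set E) := by
    rw [Submodule.dense_iff_topologicalClosure_eq_top, Submodule.topologicalClosure_eq_top_iff,
      X.orthogonal_range, ← ContinuousLinearMap.star_eq_adjoint, hX.star_eq]
    exact LinearMap.ker_eq_bot'.2 hinj
  obtain ⟨_, ⟨w, rfl⟩, hw⟩ := Metric.mem_closure_iff.1 (hd v) r hr
  refine ⟨‖w‖, norm_nonneg _, fun f => ?_⟩
  have e : inner ℂ v f = inner ℂ (v - X w) f + inner ℂ w (X f) := by
    rw [inner_sub_left, ← ContinuousLinearMap.adjoint_inner_left,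
      ← ContinuousLinearMap.star_eq_adjoint, hX.star_eq]
    ring
  rw [e]
  refine (norm_add_le _ _).trans (add_le_add ((norm_inner_le_norm _ _).trans ?_)
    (norm_inner_le_norm _ _))
  gcongr
  rw [← dist_eq_norm]
  exact hw.le

theorem boundedFun_of_tendsto {a : ℤ × ℤ → ℂ} (ha : Tendsto a cofinite (nhds 0)) :
    BoundedFun a := by
  obtain ⟨C, hC⟩ := ha.norm.bddAbove_range_of_cofinite
  exact ⟨C, fun n => hC ⟨n, rfl⟩⟩

theorem negligible_mulOp_mul {X : H2 →L[ℂ] H2} (hX : IsSelfAdjoint X)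
    (hinj : ∀ f, X f = 0 → f = 0) {a : ℤ × ℤ → ℂ} (ha : Tendsto a cofinite (nhds 0))
    (Y : H2 →L[ℂ] H2) : Negligible X (mulOp a * Y) := by
  intro r hr
  have hb := boundedFun_of_tendsto ha
  set s := r / 2 / (‖Y‖ + 1) with hs
  have hs0 : 0 < s := by positivity
  obtain ⟨S, hS⟩ : ∃ S : Finset (ℤ × ℤ), ∀ n ∉ S, ‖a n‖ ≤ s := by
    have h1 : ∀ᶠ n in cofinite, ‖a n‖ ≤ s := by
      have := ha.norm.eventually_lt_const (by simpa using hs0)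
      exact this.mono fun n hn => hn.le
    exact ⟨(Filter.eventually_cofinite.1 h1).toFinset, fun n hn => by simpa using hn⟩
  have h2 : ∀ g : H2, ‖mulOp a g‖ ≤ s * ‖g‖ + ∑ n ∈ S, ‖a n‖ * ‖g n‖ := by
    intro g
    set g' : H2 := ∑ n ∈ S, lp.single 2 n (a n * g n) with hg'
    have h3 : ‖g'‖ ≤ ∑ n ∈ S, ‖a n‖ * ‖g n‖ := by
      refine (norm_sum_le _ _).trans (Finset.sum_le_sum fun n _ => ?_)
      rw [lp.norm_single (by norm_num), norm_mul]
    have h4 : ‖mulOp a g - g'‖ ≤ s * ‖g‖ := by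
      refine norm_le_of_forall_norm_apply_le hs0.le fun n => ?_
      have : g' n = if n ∈ S then a n * g n else 0 := by
        rw [hg', lp.coeFn_sum, Finset.sum_apply]
        simp only [lp.single_apply, Pi.single_apply]
        rw [Finset.sum_ite_eq]
      rw [lp.coeFn_sub, Pi.sub_apply, this, mulOp_apply hb]
      split_ifs with hn
      · rw [sub_self, norm_zero]
        positivity
      · rw [sub_zero, norm_mul]
        gcongr
        exact hS n hn
    calc _ = ‖(mulOp a g - g') + g'‖ := by rw [sub_add_cancel]
      _ ≤ _ := (norm_add_le _ _).trans (add_le_add h4 h3)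
  have h5 : ∀ n ∈ S, ∃ C : ℝ, 0 ≤ C ∧ ∀ f, ‖Y f n‖ ≤
      r / 2 / (∑ n ∈ S, ‖a n‖ + 1) * ‖f‖ + C * ‖X f‖ := by
    intro n _
    obtain ⟨C, hC, h⟩ := exists_norm_inner_le hX hinj
      (ContinuousLinearMap.adjoint Y (lp.single 2 n (1 : ℂ)))
      (show 0 < r / 2 / (∑ n ∈ S, ‖a n‖ + 1) by positivity)
    refine ⟨C, hC, fun f => ?_⟩
    have := h f
    rwa [ContinuousLinearMap.adjoint_inner_left, lp.inner_single_left, RCLike.inner_apply, map_one,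
      mul_one] at this
  choose! C hC0 hC using h5
  refine ⟨∑ n ∈ S, ‖a n‖ * C n, Finset.sum_nonneg fun n hn =>
    mul_nonneg (norm_nonneg _) (hC0 n hn), fun f => ?_⟩
  have h6 : s * ‖Y f‖ ≤ r / 2 * ‖f‖ := by
    calc s * ‖Y f‖ ≤ s * ((‖Y‖ + 1) * ‖f‖) := by
          gcongr
          exact Y.le_of_opNorm_le (by linarith) f
      _ = _ := by rw [hs]; field_simp
  have h7 : ∑ n ∈ S, ‖a n‖ * ‖Y f n‖ ≤ r / 2 * ‖f‖ + (∑ n ∈ S, ‖a n‖ * C n) * ‖X f‖ := by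
    set A := ∑ n ∈ S, ‖a n‖ with hA
    have hA0 : 0 ≤ A := Finset.sum_nonneg fun n _ => norm_nonneg _
    calc _ ≤ ∑ n ∈ S, ‖a n‖ * (r / 2 / (A + 1) * ‖f‖ + C n * ‖X f‖) :=
          Finset.sum_le_sum fun n hn => mul_le_mul_of_nonneg_left (hC n hn f) (norm_nonneg _)
      _ = A * (r / 2 / (A + 1)) * ‖f‖ + (∑ n ∈ S, ‖a n‖ * C n) * ‖X f‖ := by
          simp only [mul_add, Finset.sum_add_distrib, ← mul_assoc, ← Finset.sum_mul, hA]
      _ ≤ _ := by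
          gcongr
          rw [mul_div_assoc', div_le_iff₀ (by positivity)]
          nlinarith
  rw [mul_apply_eq_comp]
  linarith [h2 (Y f)]

/-- A positive commutator estimate survives a relatively compact perturbation, provided that the
energy is not an eigenvalue. -/
theorem exists_positivity_of_negligible {H H₀ B₀ T : E →L[ℂ] E} {lam₀ c₁ : ℝ} (hc₁ : 0 < c₁)
    (hfree : ∀ f, c₁ * ‖f‖ ^ 2 ≤
      (inner ℂ f (B₀ f)).re + ‖(H₀ - (lam₀ : ℂ) • 1) f‖ ^ 2)
    (hK : Negligible (H - (lam₀ : ℂ) • 1) (H - H₀)) (hT : Negligible (H - (lam₀ : ℂ) • 1) T) :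
    ∃ c C ρ : ℝ, 0 < c ∧ 0 ≤ C ∧ 0 < ρ ∧ ρ ≤ 1 ∧ ∀ lam : ℝ, |lam - lam₀| < ρ → ∀ f,
      c * ‖f‖ ^ 2 ≤ (inner ℂ f ((B₀ + T) f)).re + C * ‖(H - (lam : ℂ) • 1) f‖ ^ 2 := by
  set X := H - (lam₀ : ℂ) • 1 with hX
  set s := min (c₁ / 8) 1 with hs
  have hs0 : 0 < s := by positivity
  have hs1 : s ≤ c₁ / 8 := min_le_left _ _
  have hs2 : s ≤ 1 := min_le_right _ _
  obtain ⟨C₁, hC₁, hK⟩ := hK (s / 4) (by positivity)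
  obtain ⟨C₂, hC₂, hT⟩ := hT s hs0
  set C := 2 * (C₁ + 1) ^ 2 + C₂ ^ 2 / (4 * s) with hC
  have hC0 : 0 ≤ C := by positivity
  have hmain : ∀ f, c₁ / 2 * ‖f‖ ^ 2 ≤ (inner ℂ f ((B₀ + T) f)).re + C * ‖X f‖ ^ 2 := by
    intro f
    have h1 : ‖(H₀ - (lam₀ : ℂ) • 1) f‖ ≤ s / 4 * ‖f‖ + (C₁ + 1) * ‖X f‖ := by
      have : (H₀ - (lam₀ : ℂ) • 1) f = X f - (H - H₀) f := by
        simp only [hX, sub_apply]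
        abel
      rw [this]
      linarith [norm_sub_le (X f) ((H - H₀) f), hK f]
    have h1' : ‖(H₀ - (lam₀ : ℂ) • 1) f‖ ^ 2 ≤
        2 * ‖f‖ ^ 2 * (s / 4) ^ 2 + 2 * (C₁ + 1) ^ 2 * ‖X f‖ ^ 2 := by
      have := pow_le_pow_left₀ (norm_nonneg _) h1 2
      nlinarith [sq_nonneg (s / 4 * ‖f‖ - (C₁ + 1) * ‖X f‖)]
    have h2 : -(‖f‖ * (s * ‖f‖ + C₂ * ‖X f‖)) ≤ (inner ℂ f (T f)).re := by
      have h3 := (Complex.abs_re_le_norm _).trans (norm_inner_le_norm (𝕜 := ℂ) f (T f))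
      have h4 : ‖f‖ * ‖T f‖ ≤ ‖f‖ * (s * ‖f‖ + C₂ * ‖X f‖) := by
        gcongr
        exact hT f
      linarith [neg_abs_le (inner ℂ f (T f)).re]
    have h5 : C₂ * ‖f‖ * ‖X f‖ ≤ s * ‖f‖ ^ 2 + C₂ ^ 2 / (4 * s) * ‖X f‖ ^ 2 := by
      have e : s * ‖f‖ ^ 2 + C₂ ^ 2 / (4 * s) * ‖X f‖ ^ 2 - C₂ * ‖f‖ * ‖X f‖ =
          (2 * s * ‖f‖ - C₂ * ‖X f‖) ^ 2 / (4 * s) := by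
        field_simp
        ring
      have : 0 ≤ (2 * s * ‖f‖ - C₂ * ‖X f‖) ^ 2 / (4 * s) := by positivity
      linarith
    have h6 : s ^ 2 * ‖f‖ ^ 2 ≤ c₁ / 8 * ‖f‖ ^ 2 := by
      gcongr
      nlinarith
    have h7 : s * ‖f‖ ^ 2 ≤ c₁ / 8 * ‖f‖ ^ 2 := by gcongr
    have h8 := hfree f
    rw [add_apply, inner_add_right, Complex.add_re, hC]
    have h9 : 0 ≤ c₁ * ‖f‖ ^ 2 := by positivity
    linarith
  refine ⟨c₁ / 4, 2 * C, min 1 (c₁ / (8 * (C + 1))), by positivity, by positivity, by positivity,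
    min_le_left _ _, fun lam hlam f => ?_⟩
  have h1 := hmain f
  have h2 : ‖X f‖ ≤ ‖(H - (lam : ℂ) • 1) f‖ + |lam - lam₀| * ‖f‖ := by
    have : X f = (H - (lam : ℂ) • 1) f + ((lam - lam₀ : ℝ) : ℂ) • f := by
      simp only [hX, sub_apply, smul_apply, one_apply_eq_self, Complex.ofReal_sub, sub_smul]
      abel
    rw [this]
    refine (norm_add_le _ _).trans (le_of_eq ?_)
    rw [norm_smul, Complex.norm_real, Real.norm_eq_abs]
  have h3 : ‖X f‖ ^ 2 ≤ 2 * ‖(H - (lam : ℂ) • 1) f‖ ^ 2 + 2 * |lam - lam₀| * ‖f‖ ^ 2 := by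
    have h4 := pow_le_pow_left₀ (norm_nonneg _) h2 2
    have h5 : |lam - lam₀| ≤ 1 := hlam.le.trans (min_le_left _ _)
    have h6 : |lam - lam₀| ^ 2 ≤ |lam - lam₀| := by
      nlinarith [abs_nonneg (lam - lam₀)]
    nlinarith [sq_nonneg (‖(H - (lam : ℂ) • 1) f‖ - |lam - lam₀| * ‖f‖),
      mul_le_mul_of_nonneg_right h6 (sq_nonneg ‖f‖)]
  have h7 : C * |lam - lam₀| ≤ c₁ / 8 := by
    have h8 : |lam - lam₀| ≤ c₁ / (8 * (C + 1)) := hlam.le.trans (min_le_right _ _)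
    calc C * |lam - lam₀| ≤ (C + 1) * (c₁ / (8 * (C + 1))) := by gcongr; linarith
      _ = _ := by field_simp
  nlinarith [mul_le_mul_of_nonneg_left h3 hC0, mul_le_mul_of_nonneg_right h7 (sq_nonneg ‖f‖)]

end RelativeCompactness

section Dilations

theorem abs_le_jap (t : ℝ) : |t| ≤ jap t := by
  rw [jap, ← Real.sqrt_sq_eq_abs]
  exact Real.sqrt_le_sqrt (by linarith)

theorem half_le_jap (t : ℝ) : 1 / 2 ≤ jap t :=
  Real.le_sqrt_of_sq_le (by nlinarith [sq_nonneg t])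

theorem jap_le_add_abs (s t : ℝ) : jap s ≤ jap t + |s - t| := by
  have h1 := half_le_jap t
  have h2 := abs_le_jap t
  have h3 : jap t ^ 2 = 1 / 2 + t ^ 2 := Real.sq_sqrt (by positivity)
  refine Real.sqrt_le_iff.2 ⟨by positivity, ?_⟩
  have h4 : t * (s - t) ≤ jap t * |s - t| := by
    refine (le_abs_self _).trans ?_
    rw [abs_mul]
    gcongr
  nlinarith [sq_abs (s - t)]

theorem one_le_Lam (n : ℤ × ℤ) : 1 ≤ Lam n := by
  have h1 := half_le_jap n.1
  have h2 := half_le_jap n.2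
  rw [Lam]
  linarith

theorem Lam_pos (n : ℤ × ℤ) : 0 < Lam n := one_pos.trans_le (one_le_Lam n)

theorem Lam_le_three_mul {n l : ℤ × ℤ} (h : l - n ∈ nbrs) : Lam n ≤ 3 * Lam l := by
  obtain ⟨h1, h2⟩ := abs_le_one_of_mem_nbrs _ h
  have h3 := jap_le_add_abs (n.1 : ℝ) l.1
  have h4 := jap_le_add_abs (n.2 : ℝ) l.2
  have h5 : |(n.1 : ℝ) - l.1| ≤ 1 := by
    rw [abs_sub_comm]
    exact_mod_cast h1
  have h6 : |(n.2 : ℝ) - l.2| ≤ 1 := by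
    rw [abs_sub_comm]
    exact_mod_cast h2
  have h7 := one_le_Lam l
  rw [Lam] at h7 ⊢
  rw [Lam]
  linarith

/-- The truncation of an integer to the interval `[-L, L]`. -/
def clip (L : ℕ) (t : ℤ) : ℝ := max (-L) (min L t)

theorem abs_clip_sub_clip_le (L : ℕ) (s t : ℤ) : |clip L s - clip L t| ≤ |(s : ℝ) - t| :=
  (abs_max_sub_max_le_max _ _ _ _).trans (by
    rw [sub_self, abs_zero, max_eq_right (abs_nonneg _)]
    refine (abs_min_sub_min_le_max _ _ _ _).trans ?_
    rw [sub_self, abs_zero, max_eq_right (abs_nonneg _)])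

theorem clip_zero (L : ℕ) : clip L 0 = 0 := by
  simp [clip]

theorem abs_clip_le_abs (L : ℕ) (t : ℤ) : |clip L t| ≤ |(t : ℝ)| := by
  simpa [clip_zero] using abs_clip_sub_clip_le L t 0

theorem abs_clip_le (L : ℕ) (t : ℤ) : |clip L t| ≤ L := by
  have hL : (0 : ℝ) ≤ L := L.cast_nonneg
  exact abs_le.2 ⟨le_max_left _ _, max_le (by linarith) (min_le_left _ _)⟩

theorem tendsto_clip (t : ℤ) : Tendsto (fun L => clip L t) atTop (nhds (t : ℝ)) := by
  refine tendsto_const_nhds.congr' ?_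
  filter_upwards [eventually_ge_atTop t.natAbs] with L hL
  have h1 : |(t : ℝ)| ≤ L := by
    rw [← Int.cast_abs, Int.abs_eq_natAbs, Int.cast_natCast]
    exact_mod_cast hL
  obtain ⟨h2, h3⟩ := abs_le.1 h1
  rw [clip, min_eq_right h3, max_eq_right h2]

/-- The coefficient of the truncated dilation generator along the edge from `n` to `n + e`. -/
def edge (L : ℕ) (e n : ℤ × ℤ) : ℝ :=
  e.1 * (clip L n.1 + clip L (n.1 + e.1)) + e.2 * (clip L n.2 + clip L (n.2 + e.2))

/-- The coefficient of the dilation generator along the edge from `n` to `n + e`. -/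
def edgeLim (e n : ℤ × ℤ) : ℝ := e.1 * (n.1 + (n.1 + e.1)) + e.2 * (n.2 + (n.2 + e.2))

theorem tendsto_edge (e n : ℤ × ℤ) : Tendsto (fun L => edge L e n) atTop (nhds (edgeLim e n)) := by
  have h1 := (((tendsto_clip n.1).add (tendsto_clip (n.1 + e.1))).const_mul (e.1 : ℝ)).add
    (((tendsto_clip n.2).add (tendsto_clip (n.2 + e.2))).const_mul (e.2 : ℝ))
  simpa [edge, edgeLim] using h1

theorem edge_neg (L : ℕ) (e n : ℤ × ℤ) : edge L (-e) n = -edge L e (n - e) := by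
  simp only [edge, Prod.fst_neg, Prod.snd_neg, Prod.fst_sub, Prod.snd_sub, sub_add_cancel]
  push_cast
  simp only [← sub_eq_add_neg]
  ring

theorem abs_edge_le_nat (L : ℕ) (e n : ℤ × ℤ) :
    |edge L e n| ≤ |(e.1 : ℝ)| * (L + L) + |(e.2 : ℝ)| * (L + L) := by
  refine (abs_add_le _ _).trans (add_le_add ?_ ?_) <;> rw [abs_mul] <;> gcongr <;>
    exact (abs_add_le _ _).trans (add_le_add (abs_clip_le _ _) (abs_clip_le _ _))

theorem abs_edge_add_sub_edge_le (L : ℕ) (e n d : ℤ × ℤ) :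
    |edge L e (n + d) - edge L e n| ≤
      |(e.1 : ℝ)| * (|(d.1 : ℝ)| + |(d.1 : ℝ)|) + |(e.2 : ℝ)| * (|(d.2 : ℝ)| + |(d.2 : ℝ)|) := by
  have e1 : edge L e (n + d) - edge L e n =
      e.1 * ((clip L (n.1 + d.1) - clip L n.1) + (clip L (n.1 + d.1 + e.1) - clip L (n.1 + e.1)))
      + e.2 * ((clip L (n.2 + d.2) - clip L n.2)
        + (clip L (n.2 + d.2 + e.2) - clip L (n.2 + e.2))) := by
    simp only [edge, Prod.fst_add, Prod.snd_add]
    ring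
  rw [e1]
  refine (abs_add_le _ _).trans (add_le_add ?_ ?_) <;> rw [abs_mul] <;> gcongr <;>
    refine (abs_add_le _ _).trans (add_le_add ((abs_clip_sub_clip_le _ _ _).trans_eq ?_)
      ((abs_clip_sub_clip_le _ _ _).trans_eq ?_)) <;> push_cast <;> congr 1 <;> ring

theorem abs_edge_le_Lam (L : ℕ) {e : ℤ × ℤ} (he : e ∈ nbrs) (n : ℤ × ℤ) :
    |edge L e n| ≤ 4 * Lam (n + e) := by
  obtain ⟨h1, h2⟩ := abs_le_one_of_mem_nbrs e he
  have h1' : |(e.1 : ℝ)| ≤ 1 := by exact_mod_cast h1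
  have h2' : |(e.2 : ℝ)| ≤ 1 := by exact_mod_cast h2
  have h3 : ∀ s t : ℤ, |(t : ℝ)| ≤ 1 →
      |(t : ℝ) * (clip L s + clip L (s + t))| ≤ 2 * jap ((s + t : ℤ) : ℝ) + 1 := by
    intro s t ht
    have h4 := abs_le_jap ((s + t : ℤ) : ℝ)
    have h5 : |(s : ℝ)| ≤ |((s + t : ℤ) : ℝ)| + 1 := by
      have := abs_sub ((s + t : ℤ) : ℝ) t
      have e : ((s + t : ℤ) : ℝ) - t = s := by push_cast; ring
      rw [e] at this
      linarith
    have h6 := abs_add_le (clip L s) (clip L (s + t))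
    have h7 := abs_clip_le_abs L s
    have h8 := abs_clip_le_abs L (s + t)
    rw [abs_mul]
    nlinarith [abs_nonneg (clip L s + clip L (s + t)), abs_nonneg (t : ℝ)]
  have h4 := one_le_Lam (n + e)
  have h5 := h3 n.1 e.1 h1'
  have h6 := h3 n.2 e.2 h2'
  refine (abs_add_le _ _).trans ?_
  rw [Lam, Prod.fst_add, Prod.snd_add] at *
  linarith

theorem boundedFun_edge (L : ℕ) (e : ℤ × ℤ) :
    BoundedFun fun n => Complex.I / 12 * (edge L e n : ℂ) := by
  refine ⟨‖(Complex.I / 12 : ℂ)‖ * (|(e.1 : ℝ)| * (L + L) + |(e.2 : ℝ)| * (L + L)), fun n => ?_⟩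
  rw [norm_mul, Complex.norm_real]
  gcongr
  exact abs_edge_le_nat L e n

/-- Truncated generators of dilations in the velocity variables. -/
def dil (L : ℕ) : H2 →L[ℂ] H2 :=
  ∑ e ∈ nbrs, mulOp (fun n => Complex.I / 12 * (edge L e n : ℂ)) * shift e

theorem isSelfAdjoint_dil (L : ℕ) : IsSelfAdjoint (dil L) := by
  rw [isSelfAdjoint_iff, dil, star_sum, ← sum_nbrs_neg]
  refine Finset.sum_congr rfl fun e _ => ?_
  rw [star_mul, star_shift, star_mulOp, shift_mul_mulOp, neg_neg]
  congr 2
  ext n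
  simp [edge_neg L e]
  ring

theorem norm_sum_mulOp_mul_shift_le {a : ℤ × ℤ → ℤ × ℤ → ℂ} {C : ℝ}
    (h : ∀ e ∈ nbrs, ∀ n, ‖a e n‖ ≤ C) : ‖∑ e ∈ nbrs, mulOp (a e) * shift e‖ ≤ 6 * C := by
  have hC : 0 ≤ C := (norm_nonneg _).trans (h (1, 0) (by decide) 0)
  have h1 : ∀ e ∈ nbrs, ‖mulOp (a e) * shift e‖ ≤ C := fun e he => by
    refine (norm_mul_le _ _).trans ?_
    have := mul_le_mul (norm_mulOp_le (h e he)) (norm_shift_le e) (norm_nonneg _) hC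
    rwa [mul_one] at this
  refine (norm_sum_le_of_le nbrs h1).trans_eq ?_
  rw [Finset.sum_const, show nbrs.card = 6 from rfl, nsmul_eq_mul]
  norm_num

theorem norm_dil_mul_mulOp_le (L : ℕ) {φ : ℤ × ℤ → ℂ} {C : ℝ} (h : ∀ n, Lam n * ‖φ n‖ ≤ C) :
    ‖dil L * mulOp φ‖ ≤ 2 * C := by
  have hφ : ∀ n, ‖φ n‖ ≤ C := fun n =>
    (le_mul_of_one_le_left (norm_nonneg _) (one_le_Lam n)).trans (h n)
  have e1 : dil L * mulOp φ = ∑ e ∈ nbrs,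
      mulOp ((fun n => Complex.I / 12 * (edge L e n : ℂ)) * fun n => φ (n + e)) * shift e := by
    rw [dil, Finset.sum_mul]
    refine Finset.sum_congr rfl fun e _ => ?_
    rw [mulOp_mul (boundedFun_edge L e) (.comp ⟨C, hφ⟩ _), mul_assoc, shift_mul_mulOp, mul_assoc]
  rw [e1]
  refine (norm_sum_mulOp_mul_shift_le (C := C / 3) fun e he n => ?_).trans (le_of_eq (by ring))
  rw [Pi.mul_apply, norm_mul, norm_mul, Complex.norm_real, Real.norm_eq_abs, norm_div,
    Complex.norm_I, Complex.norm_ofNat]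
  nlinarith [abs_edge_le_Lam L he n, h (n + e), norm_nonneg (φ (n + e)),
    mul_le_mul_of_nonneg_right (abs_edge_le_Lam L he n) (norm_nonneg (φ (n + e)))]

end Dilations

section CommutatorLimits

/-- The commutators of `X` with the truncated dilation generators converge strongly to `Y`. -/
def CommLim (X Y : H2 →L[ℂ] H2) : Prop :=
  ∀ f, Tendsto (fun L => (X * dil L - dil L * X) f) atTop (nhds (Y f))

variable {X Y X' Y' : H2 →L[ℂ] H2}

theorem CommLim.add (h : CommLim X Y) (h' : CommLim X' Y') : CommLim (X + X') (Y + Y') := by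
  intro f
  refine ((h f).add (h' f)).congr fun L => ?_
  rw [← add_apply]
  congr 1
  noncomm_ring

theorem CommLim.smul (h : CommLim X Y) (c : ℂ) : CommLim (c • X) (c • Y) := by
  intro f
  refine ((h f).const_smul c).congr fun L => ?_
  rw [← smul_apply, smul_sub, smul_mul_assoc, mul_smul_comm]

theorem commLim_zero : CommLim 0 0 := by
  intro f
  simp

theorem commLim_sum {ι : Type*} (s : Finset ι) {X Y : ι → H2 →L[ℂ] H2}
    (h : ∀ i, CommLim (X i) (Y i)) : CommLim (∑ i ∈ s, X i) (∑ i ∈ s, Y i) := by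
  classical
  induction s using Finset.induction_on with
  | empty => simpa using commLim_zero
  | insert i s hi ih =>
    rw [Finset.sum_insert hi, Finset.sum_insert hi]
    exact (h i).add ih

theorem CommLim.exists_norm_le (h : CommLim X Y) :
    ∃ C : ℝ, ∀ L, ‖X * dil L - dil L * X‖ ≤ C := by
  refine banach_steinhaus fun f => ?_
  obtain ⟨C, hC⟩ := (h f).norm.bddAbove_range
  exact ⟨C, fun L => hC ⟨L, rfl⟩⟩

theorem CommLim.mul (h : CommLim X Y) (h' : CommLim X' Y') :
    CommLim (X * X') (Y * X' + X * Y') := by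
  intro f
  refine ((h (X' f)).add ((X.continuous.tendsto _).comp (h' f))).congr fun L => ?_
  simp only [Function.comp_apply, ← mul_apply_eq_comp]
  rw [← add_apply]
  congr 1
  noncomm_ring

theorem tendsto_sum_mulOp_mul_apply {a : ℕ → ℤ × ℤ → ℤ × ℤ → ℂ} {b : ℤ × ℤ → ℤ × ℤ → ℂ} {C : ℝ}
    (ha : ∀ e ∈ nbrs, ∀ L n, ‖a L e n‖ ≤ C)
    (hab : ∀ e n, Tendsto (fun L => a L e n) atTop (nhds (b e n))) (Z : ℤ × ℤ → H2 →L[ℂ] H2)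
    (f : H2) : Tendsto (fun L => (∑ e ∈ nbrs, mulOp (a L e) * Z e) f) atTop
      (nhds ((∑ e ∈ nbrs, mulOp (b e) * Z e) f)) := by
  simp only [sum_apply, mul_apply_eq_comp]
  exact tendsto_finsetSum _ fun e he => tendsto_mulOp_apply (ha e he) (hab e) (Z e f)

theorem commLim_shift (d : ℤ × ℤ) :
    CommLim (shift d) (((d.1 : ℂ) • vel₁ + (d.2 : ℂ) • vel₂) * shift d) := by
  intro f
  have h1 := tendsto_sum_mulOp_mul_apply
    (a := fun L e n => Complex.I / 12 * ((edge L e (n + d) - edge L e n : ℝ) : ℂ))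
    (b := fun e n => Complex.I / 12 * ((edgeLim e (n + d) - edgeLim e n : ℝ) : ℂ))
    (C := 1 / 12 * (1 * (|(d.1 : ℝ)| + |(d.1 : ℝ)|) + 1 * (|(d.2 : ℝ)| + |(d.2 : ℝ)|)))
    (fun e he L n => by
      obtain ⟨h1, h2⟩ := abs_le_one_of_mem_nbrs e he
      have h1' : |(e.1 : ℝ)| ≤ 1 := by exact_mod_cast h1
      have h2' : |(e.2 : ℝ)| ≤ 1 := by exact_mod_cast h2
      rw [norm_mul, norm_div, Complex.norm_I, Complex.norm_ofNat, Complex.norm_real,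
        Real.norm_eq_abs]
      gcongr
      refine (abs_edge_add_sub_edge_le L e n d).trans ?_
      gcongr)
    (fun e n => (((tendsto_edge e (n + d)).sub (tendsto_edge e n)).ofReal).const_mul _)
    (fun e => shift e * shift d) f
  convert h1 using 1
  · ext1 L
    congr 1
    rw [dil, Finset.mul_sum, Finset.sum_mul, ← Finset.sum_sub_distrib]
    refine Finset.sum_congr rfl fun e _ => ?_
    rw [← mul_assoc, shift_mul_mulOp, mul_assoc, ← shift_add, add_comm d e, shift_add,
      mul_assoc, ← sub_mul, ← mulOp_sub ((boundedFun_edge L e).comp _) (boundedFun_edge L e)]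
    congr 2
    ext n
    simp only [Pi.sub_apply, Complex.ofReal_sub]
    ring
  · congr 2
    rw [vel₁, vel₂, smul_smul, smul_smul, Finset.smul_sum, Finset.smul_sum,
      ← Finset.sum_add_distrib, Finset.sum_mul]
    refine Finset.sum_congr rfl fun e _ => ?_
    have e1 : (fun n => Complex.I / 12 * ((edgeLim e (n + d) - edgeLim e n : ℝ) : ℂ)) =
        fun _ => Complex.I / 6 * (d.1 * e.1 + d.2 * e.2) := by
      ext n
      simp only [edgeLim, Prod.fst_add, Prod.snd_add]
      push_cast
      ring
    rw [e1, mulOp_const, smul_smul, smul_smul, ← add_smul, smul_mul_assoc, smul_mul_assoc, one_mul]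
    congr 1
    ring

theorem commLim_freeLap : CommLim freeLap (-(Complex.I • freeComm)) := by
  have h : CommLim freeLap _ := (commLim_sum nbrs fun d => commLim_shift d).smul (1 / 6)
  convert h using 1
  have e1 : ∑ d ∈ nbrs, ((d.1 : ℂ) • vel₁ + (d.2 : ℂ) • vel₂) * shift d =
      vel₁ * ∑ d ∈ nbrs, (d.1 : ℂ) • shift d + vel₂ * ∑ d ∈ nbrs, (d.2 : ℂ) • shift d := by
    rw [Finset.mul_sum, Finset.mul_sum, ← Finset.sum_add_distrib]
    refine Finset.sum_congr rfl fun d _ => ?_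
    rw [add_mul, smul_mul_assoc, smul_mul_assoc, mul_smul_comm, mul_smul_comm]
  have e2 : ∀ Z : H2 →L[ℂ] H2, (1 / 6 : ℂ) • Z = (-Complex.I) • ((Complex.I / 6) • Z) := by
    intro Z
    rw [smul_smul]
    congr 1
    linear_combination (1 / 6) * Complex.I_mul_I
  rw [e1, smul_add, ← mul_smul_comm, ← mul_smul_comm, e2, e2, ← vel₁, ← vel₂, mul_smul_comm,
    mul_smul_comm, ← smul_add, neg_smul, freeComm]

theorem exists_commLim_vel₁ : ∃ Y, CommLim vel₁ Y :=
  ⟨_, (commLim_sum nbrs fun d => (commLim_shift d).smul _).smul _⟩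

theorem exists_commLim_vel₂ : ∃ Y, CommLim vel₂ Y :=
  ⟨_, (commLim_sum nbrs fun d => (commLim_shift d).smul _).smul _⟩

theorem exists_commLim_freeComm : ∃ Y, CommLim freeComm Y := by
  obtain ⟨Y₁, h₁⟩ := exists_commLim_vel₁
  obtain ⟨Y₂, h₂⟩ := exists_commLim_vel₂
  exact ⟨_, (h₁.mul h₁).add (h₂.mul h₂)⟩

/-- The limit of the commutators of a multiplication operator with the dilation generators. -/
def gradOp (g : ℤ × ℤ → ℝ) : H2 →L[ℂ] H2 :=
  ∑ e ∈ nbrs, mulOp (fun n => Complex.I / 12 * ((edgeLim e n * (g n - g (n + e)) : ℝ) : ℂ)) *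
    shift e

theorem commLim_mulOp {g : ℤ × ℤ → ℝ} (hb : BoundedFun fun n => (g n : ℂ)) {C : ℝ}
    (hg : ∀ e ∈ nbrs, ∀ L n, |edge L e n| * |g n - g (n + e)| ≤ C) :
    CommLim (mulOp fun n => (g n : ℂ)) (gradOp g) := by
  intro f
  have h1 := tendsto_sum_mulOp_mul_apply
    (a := fun L e n => Complex.I / 12 * ((edge L e n * (g n - g (n + e)) : ℝ) : ℂ))
    (b := fun e n => Complex.I / 12 * ((edgeLim e n * (g n - g (n + e)) : ℝ) : ℂ))
    (C := 1 / 12 * C)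
    (fun e he L n => by
      rw [norm_mul, norm_div, Complex.norm_I, Complex.norm_ofNat, Complex.norm_real,
        Real.norm_eq_abs, abs_mul]
      gcongr
      exact hg e he L n)
    (fun e n => (((tendsto_edge e n).mul_const _).ofReal).const_mul _) shift f
  refine h1.congr fun L => ?_
  congr 1
  rw [dil, Finset.mul_sum, Finset.sum_mul, ← Finset.sum_sub_distrib]
  refine Finset.sum_congr rfl fun e _ => ?_
  have hb' : BoundedFun fun n => (g (n + e) : ℂ) := hb.comp _
  rw [mul_assoc, shift_mul_mulOp, ← mul_assoc, ← mul_assoc, ← sub_mul,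
    ← mulOp_mul hb (boundedFun_edge L e), ← mulOp_mul (boundedFun_edge L e) hb',
    ← mulOp_sub (hb.mul (boundedFun_edge L e)) ((boundedFun_edge L e).mul hb')]
  congr 2
  ext n
  simp only [Pi.sub_apply, Pi.mul_apply]
  push_cast
  ring

end CommutatorLimits

section Decay

/-- The differences of `g` along the edges, weighted by the dilation coefficients, decay like
`Λ ^ (-s)`. -/
def GradDecay (s : ℝ) (g : ℤ × ℤ → ℝ) : Prop :=
  ∃ C : ℝ, ∀ e ∈ nbrs, ∀ L n, Lam n ^ s * (|edge L e n| * |g n - g (n + e)|) ≤ C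

theorem abs_edge_one_zero_le (L : ℕ) (n : ℤ × ℤ) : |edge L (1, 0) n| ≤ 4 * jap n.1 := by
  have h1 := abs_clip_le_abs L n.1
  have h2 := abs_clip_sub_clip_le L (n.1 + 1) n.1
  have h3 := abs_le_jap (n.1 : ℝ)
  have h4 := half_le_jap (n.1 : ℝ)
  have e1 : edge L (1, 0) n = 2 * clip L n.1 + (clip L (n.1 + 1) - clip L n.1) := by
    simp [edge]
    ring
  have e2 : |((n.1 + 1 : ℤ) : ℝ) - n.1| = 1 := by
    push_cast
    simp
  rw [e1]
  refine (abs_add_le _ _).trans ?_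
  rw [abs_mul, abs_two]
  linarith

theorem abs_edge_zero_one_le (L : ℕ) (n : ℤ × ℤ) : |edge L (0, 1) n| ≤ 4 * jap n.2 := by
  have h : edge L (0, 1) n = edge L (1, 0) (n.2, n.1) := by
    simp [edge]
  rw [h]
  exact abs_edge_one_zero_le L (n.2, n.1)

theorem abs_edge_one_neg_one_le (L : ℕ) (n : ℤ × ℤ) :
    |edge L (1, -1) n| ≤ 6 * jap ((n.1 : ℝ) - n.2) := by
  have h1 := abs_clip_sub_clip_le L n.1 n.2
  have h2 := abs_clip_sub_clip_le L (n.1 + 1) n.1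
  have h3 := abs_clip_sub_clip_le L n.2 (n.2 - 1)
  have h4 := abs_le_jap ((n.1 : ℝ) - n.2)
  have h5 := half_le_jap ((n.1 : ℝ) - n.2)
  have e1 : edge L (1, -1) n = 2 * (clip L n.1 - clip L n.2) +
      ((clip L (n.1 + 1) - clip L n.1) + (clip L n.2 - clip L (n.2 - 1))) := by
    simp [edge, ← sub_eq_add_neg]
    ring
  have e2 : |((n.1 + 1 : ℤ) : ℝ) - n.1| = 1 := by
    push_cast
    simp
  have e3 : |(n.2 : ℝ) - ((n.2 - 1 : ℤ) : ℝ)| = 1 := by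
    push_cast
    simp
  rw [e1]
  refine (abs_add_le _ _).trans ?_
  have h6 := abs_add_le (clip L (n.1 + 1) - clip L n.1) (clip L n.2 - clip L (n.2 - 1))
  rw [abs_mul, abs_two]
  linarith

theorem Lam_rpow_le {n l : ℤ × ℤ} (h : l - n ∈ nbrs) {s : ℝ} (hs : 0 ≤ s) :
    Lam n ^ s ≤ 3 ^ s * Lam l ^ s := by
  rw [← Real.mul_rpow (by norm_num) (Lam_pos l).le]
  exact Real.rpow_le_rpow (Lam_pos n).le (Lam_le_three_mul h) hs

theorem edge_decay_neg {s C : ℝ} (hs : 0 ≤ s) {g : ℤ × ℤ → ℝ} {e : ℤ × ℤ} (he : -e ∈ nbrs)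
    (h : ∀ L n, Lam n ^ s * (|edge L e n| * |g n - g (n + e)|) ≤ C) (L : ℕ) (n : ℤ × ℤ) :
    Lam n ^ s * (|edge L (-e) n| * |g n - g (n + -e)|) ≤ 3 ^ s * C := by
  have h1 := h L (n - e)
  rw [sub_add_cancel, abs_sub_comm] at h1
  rw [edge_neg, abs_neg, ← sub_eq_add_neg]
  have h2 : Lam n ^ s ≤ 3 ^ s * Lam (n - e) ^ s :=
    Lam_rpow_le (by rwa [sub_sub_cancel_left]) hs
  calc _ ≤ 3 ^ s * Lam (n - e) ^ s * (|edge L e (n - e)| * |g n - g (n - e)|) := by gcongr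
    _ = 3 ^ s * (Lam (n - e) ^ s * (|edge L e (n - e)| * |g n - g (n - e)|)) := by ring
    _ ≤ 3 ^ s * C := by gcongr

theorem edge_decay_of_le {s ε C K : ℝ} (hs : s ≤ ε) (hK : 0 ≤ K) {g : ℤ × ℤ → ℝ} {e : ℤ × ℤ}
    {w : ℤ × ℤ → ℝ} (hw : ∀ n, 0 ≤ w n) (he : ∀ L n, |edge L e n| ≤ K * w n)
    (h : ∀ n, Lam n ^ ε * w n * |g n - g (n + e)| ≤ C) (L : ℕ) (n : ℤ × ℤ) :
    Lam n ^ s * (|edge L e n| * |g n - g (n + e)|) ≤ K * C := by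
  have h1 : Lam n ^ s ≤ Lam n ^ ε := Real.rpow_le_rpow_of_exponent_le (one_le_Lam n) hs
  have h2 := hw n
  calc _ ≤ Lam n ^ ε * (K * w n * |g n - g (n + e)|) := by
        have := (Real.rpow_pos_of_pos (Lam_pos n) s).le
        have := (Real.rpow_pos_of_pos (Lam_pos n) ε).le
        gcongr
        exact he L n
    _ = K * (Lam n ^ ε * w n * |g n - g (n + e)|) := by ring
    _ ≤ K * C := by
        gcongr
        exact h n

theorem gradDecay_of_forall_le {s ε : ℝ} (hs0 : 0 ≤ s) (hs : s ≤ ε) {g : ℤ × ℤ → ℝ}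
    (h1 : ∃ C : ℝ, ∀ n : ℤ × ℤ, Lam n ^ ε * jap (n.1 : ℝ) * |g n - g (n.1 + 1, n.2)| ≤ C)
    (h2 : ∃ C : ℝ, ∀ n : ℤ × ℤ, Lam n ^ ε * jap (n.2 : ℝ) * |g n - g (n.1, n.2 + 1)| ≤ C)
    (h3 : ∃ C : ℝ, ∀ n : ℤ × ℤ,
      Lam n ^ ε * jap ((n.1 : ℝ) - (n.2 : ℝ)) * |g n - g (n.1 + 1, n.2 - 1)| ≤ C) :
    GradDecay s g := by
  have hj : ∀ t, 0 ≤ jap t := fun t => Real.sqrt_nonneg _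
  obtain ⟨C₁, h1⟩ := h1
  obtain ⟨C₂, h2⟩ := h2
  obtain ⟨C₃, h3⟩ := h3
  have k1 := edge_decay_of_le (g := g) (e := (1, 0)) (C := C₁) hs (by norm_num)
    (fun n => hj n.1) abs_edge_one_zero_le (fun n => by simpa [Prod.add_def] using h1 n)
  have k2 := edge_decay_of_le (g := g) (e := (0, 1)) (C := C₂) hs (by norm_num)
    (fun n => hj n.2) abs_edge_zero_one_le (fun n => by simpa [Prod.add_def] using h2 n)
  have k3 := edge_decay_of_le (g := g) (e := (1, -1)) (C := C₃) hs (by norm_num)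
    (fun n => hj (n.1 - n.2)) abs_edge_one_neg_one_le
    (fun n => by simpa [Prod.add_def, ← sub_eq_add_neg] using h3 n)
  have m1 := edge_decay_neg hs0 (by decide) k1
  have m2 := edge_decay_neg hs0 (by decide) k2
  have m3 := edge_decay_neg hs0 (by decide) k3
  have h : ∀ e ∈ nbrs, ∃ C, ∀ L n, Lam n ^ s * (|edge L e n| * |g n - g (n + e)|) ≤ C := by
    intro e he
    fin_cases he
    exacts [⟨_, k1⟩, ⟨_, m1⟩, ⟨_, k2⟩, ⟨_, m2⟩, ⟨_, k3⟩, ⟨_, m3⟩]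
  choose! C hC using h
  refine ⟨∑ e ∈ nbrs, |C e|, fun e he L n => (hC e he L n).trans ((le_abs_self _).trans ?_)⟩
  exact Finset.single_le_sum (f := fun e => |C e|) (fun _ _ => abs_nonneg _) he

theorem GradDecay.of_abs_sub_le {s K : ℝ} {g p : ℤ × ℤ → ℝ} (h : GradDecay s g) (hK : 0 ≤ K)
    (hp : ∀ n l, |p n - p l| ≤ K * |g n - g l|) : GradDecay s p := by
  obtain ⟨C, hC⟩ := h
  refine ⟨K * C, fun e he L n => ?_⟩
  have h1 := (Real.rpow_pos_of_pos (Lam_pos n) s).le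
  calc _ ≤ Lam n ^ s * (|edge L e n| * (K * |g n - g (n + e)|)) := by
        gcongr
        exact hp _ _
    _ = K * (Lam n ^ s * (|edge L e n| * |g n - g (n + e)|)) := by ring
    _ ≤ K * C := by
        gcongr
        exact hC e he L n

theorem GradDecay.commLim {s : ℝ} (hs : 0 ≤ s) {g : ℤ × ℤ → ℝ} (h : GradDecay s g)
    (hb : BoundedFun fun n => (g n : ℂ)) : CommLim (mulOp fun n => (g n : ℂ)) (gradOp g) := by
  obtain ⟨C, hC⟩ := h
  refine commLim_mulOp hb (C := C) fun e he L n => (le_mul_of_one_le_left (by positivity) ?_).trans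
    (hC e he L n)
  exact Real.one_le_rpow (one_le_Lam n) hs

/-- The operator of multiplication by `Λ ^ (-s)`. -/
def weight (s : ℝ) : H2 →L[ℂ] H2 := mulOp fun n => ((Lam n ^ (-s) : ℝ) : ℂ)

theorem norm_Lam_rpow_neg_le {s : ℝ} (hs : 0 ≤ s) (n : ℤ × ℤ) :
    ‖((Lam n ^ (-s) : ℝ) : ℂ)‖ ≤ 1 := by
  rw [Complex.norm_real, Real.norm_of_nonneg (Real.rpow_pos_of_pos (Lam_pos n) _).le]
  exact Real.rpow_le_one_of_one_le_of_nonpos (one_le_Lam n) (by linarith)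

theorem weight_dvd_mulOp {s C : ℝ} (hs : 0 ≤ s) {a : ℤ × ℤ → ℂ}
    (h : ∀ n, Lam n ^ s * ‖a n‖ ≤ C) : weight s ∣ mulOp a := by
  have h1 : BoundedFun fun n => ((Lam n ^ s : ℝ) : ℂ) * a n := by
    refine ⟨C, fun n => ?_⟩
    rw [norm_mul, Complex.norm_real, Real.norm_of_nonneg (Real.rpow_pos_of_pos (Lam_pos n) _).le]
    exact h n
  refine ⟨mulOp fun n => ((Lam n ^ s : ℝ) : ℂ) * a n, ?_⟩
  rw [weight, ← mulOp_mul ⟨1, norm_Lam_rpow_neg_le hs⟩ h1]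
  congr 1
  ext n
  rw [Pi.mul_apply, ← mul_assoc, ← Complex.ofReal_mul, ← Real.rpow_add (Lam_pos n),
    neg_add_cancel, Real.rpow_zero, Complex.ofReal_one, one_mul]

theorem weight_dvd_sum {ι : Type*} (t : Finset ι) {s : ℝ} {X : ι → H2 →L[ℂ] H2}
    (h : ∀ i ∈ t, weight s ∣ X i) : weight s ∣ ∑ i ∈ t, X i := by
  choose! Y hY using h
  exact ⟨∑ i ∈ t, Y i, by rw [Finset.mul_sum]; exact Finset.sum_congr rfl hY⟩

theorem weight_dvd_smul {s : ℝ} {X : H2 →L[ℂ] H2} (h : weight s ∣ X) (c : ℂ) :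
    weight s ∣ c • X := by
  obtain ⟨Y, rfl⟩ := h
  exact ⟨c • Y, (mul_smul_comm _ _ _).symm⟩

theorem weight_dvd_mul {s : ℝ} {Z X : H2 →L[ℂ] H2} (hZ : weight s ∣ Z * weight s)
    (h : weight s ∣ X) : weight s ∣ Z * X := by
  obtain ⟨Y, rfl⟩ := h
  rw [← mul_assoc]
  exact hZ.mul_right Y

theorem weight_dvd_mulOp_mul_weight {s : ℝ} (a : ℤ × ℤ → ℂ) :
    weight s ∣ mulOp a * weight s :=
  ⟨mulOp a, commute_mulOp _ _⟩

theorem weight_dvd_shift_mul_weight {s : ℝ} (hs : 0 ≤ s) {e : ℤ × ℤ} (he : e ∈ nbrs) :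
    weight s ∣ shift e * weight s := by
  conv_rhs => rw [weight, shift_mul_mulOp]
  refine (weight_dvd_mulOp hs (C := 3 ^ s) fun n => ?_).mul_right _
  have h1 : Lam n ^ s ≤ 3 ^ s * Lam (n + e) ^ s := Lam_rpow_le (by rwa [add_sub_cancel_left]) hs
  have h2 := Real.rpow_pos_of_pos (Lam_pos (n + e)) s
  rw [Complex.norm_real, Real.norm_of_nonneg (Real.rpow_pos_of_pos (Lam_pos _) _).le,
    Real.rpow_neg (Lam_pos _).le, ← div_eq_mul_inv, div_le_iff₀ h2]
  exact h1

theorem weight_dvd_smul_sum_shift_mul_weight {s : ℝ} (hs : 0 ≤ s) (k : ℂ) (c : ℤ × ℤ → ℂ) :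
    weight s ∣ (k • ∑ e ∈ nbrs, c e • shift e) * weight s := by
  rw [smul_mul_assoc, Finset.sum_mul]
  refine weight_dvd_smul (weight_dvd_sum _ fun e he => ?_) _
  rw [smul_mul_assoc]
  exact weight_dvd_smul (weight_dvd_shift_mul_weight hs he) _

theorem weight_dvd_freeLap_mul_weight {s : ℝ} (hs : 0 ≤ s) : weight s ∣ freeLap * weight s := by
  simpa [freeLap] using weight_dvd_smul_sum_shift_mul_weight hs (1 / 6) 1

theorem weight_dvd_freeComm_mul_weight {s : ℝ} (hs : 0 ≤ s) : weight s ∣ freeComm * weight s := by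
  have h1 : weight s ∣ vel₁ * weight s := weight_dvd_smul_sum_shift_mul_weight hs _ _
  have h2 : weight s ∣ vel₂ * weight s := weight_dvd_smul_sum_shift_mul_weight hs _ _
  rw [freeComm, add_mul, mul_assoc, mul_assoc]
  exact dvd_add (weight_dvd_mul h1 h1) (weight_dvd_mul h2 h2)

theorem GradDecay.weight_dvd_gradOp {s : ℝ} (hs : 0 ≤ s) {g : ℤ × ℤ → ℝ} (h : GradDecay s g) :
    weight s ∣ gradOp g := by
  obtain ⟨C, hC⟩ := h
  refine weight_dvd_sum _ fun e he =>
    (weight_dvd_mulOp hs (C := 1 / 12 * C) fun n => ?_).mul_right _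
  have h1 : Lam n ^ s * (|edgeLim e n| * |g n - g (n + e)|) ≤ C :=
    le_of_tendsto (((tendsto_edge e n).abs.mul_const _).const_mul _)
      (Eventually.of_forall fun L => hC e he L n)
  rw [norm_mul, norm_div, Complex.norm_I, Complex.norm_ofNat, Complex.norm_real,
    Real.norm_eq_abs, abs_mul]
  linarith

theorem weight_dvd_commutator {s : ℝ} {P F B G G' : H2 →L[ℂ] H2} (hG : weight s ∣ G)
    (hG' : weight s ∣ G') (hP1 : weight s ∣ P - 1) (hP : weight s ∣ P * weight s)
    (hF : weight s ∣ F * weight s) (hB : weight s ∣ B * weight s) :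
    weight s ∣
      Complex.I • ((G * F + P * -(Complex.I • B)) * P + P * F * G + G') - B := by
  have e1 : Complex.I • ((G * F + P * -(Complex.I • B)) * P + P * F * G + G') - B =
      Complex.I • (G * (F * P) + P * (F * G) + G') + ((P - 1) * (B * P) + B * (P - 1)) := by
    have e2 : Complex.I • ((P * -(Complex.I • B)) * P) = P * B * P := by
      rw [mul_neg, neg_mul, mul_smul_comm, smul_mul_assoc, smul_neg, smul_smul, Complex.I_mul_I,
        neg_smul, one_smul, neg_neg]
    rw [add_mul, smul_add, smul_add, smul_add, e2, smul_add, smul_add]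
    simp only [mul_assoc, mul_sub, sub_mul, one_mul, mul_one]
    abel
  rw [e1]
  exact dvd_add (weight_dvd_smul (dvd_add (dvd_add (hG.mul_right _)
    (weight_dvd_mul hP (weight_dvd_mul hF hG))) hG') _)
    (dvd_add (hP1.mul_right _) (weight_dvd_mul hB hP1))

end Decay

section Regularization

/-- The regularizing multiplication operator `(1 + δ Λ)⁻¹`. -/
def reg (δ : ℝ) : H2 →L[ℂ] H2 := mulOp fun n => (((1 + δ * Lam n)⁻¹ : ℝ) : ℂ)

theorem norm_reg_apply_le {δ : ℝ} (hδ : 0 < δ) (n : ℤ × ℤ) :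
    ‖(((1 + δ * Lam n)⁻¹ : ℝ) : ℂ)‖ ≤ 1 := by
  have h := mul_pos hδ (Lam_pos n)
  rw [Complex.norm_real, Real.norm_of_nonneg (by positivity)]
  exact inv_le_one_of_one_le₀ (by linarith)

theorem boundedFun_reg {δ : ℝ} (hδ : 0 < δ) :
    BoundedFun fun n => (((1 + δ * Lam n)⁻¹ : ℝ) : ℂ) := ⟨1, norm_reg_apply_le hδ⟩

theorem norm_reg_le {δ : ℝ} (hδ : 0 < δ) : ‖reg δ‖ ≤ 1 := norm_mulOp_le (norm_reg_apply_le hδ)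

theorem one_sub_reg {δ : ℝ} (hδ : 0 < δ) :
    1 - reg δ = mulOp ((fun _ => 1) - fun n => (((1 + δ * Lam n)⁻¹ : ℝ) : ℂ)) := by
  rw [mulOp_sub ⟨1, fun n => by simp⟩ (boundedFun_reg hδ), mulOp_const, one_smul, reg]

theorem reg_sub_reg {δ δ' : ℝ} (hδ : 0 < δ) (hδ' : 0 < δ') :
    reg δ' - reg δ = ((-((δ' - δ) / δ) : ℝ) : ℂ) • (reg δ' * (1 - reg δ)) := by
  have h1 : BoundedFun ((fun _ => 1) - fun n => (((1 + δ * Lam n)⁻¹ : ℝ) : ℂ)) :=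
    BoundedFun.sub ⟨1, fun n => by simp⟩ (boundedFun_reg hδ)
  have h2 : BoundedFun fun _ => ((-((δ' - δ) / δ) : ℝ) : ℂ) := ⟨_, fun n => le_rfl⟩
  rw [one_sub_reg hδ, reg, reg, ← mulOp_sub (boundedFun_reg hδ') (boundedFun_reg hδ),
    ← mulOp_mul (boundedFun_reg hδ') h1, ← one_mul (mulOp (_ * _)), ← smul_mul_assoc,
    ← mulOp_const, ← mulOp_mul h2 ((boundedFun_reg hδ').mul h1)]
  congr 1
  ext n
  have h3 := mul_pos hδ (Lam_pos n)
  have h4 := mul_pos hδ' (Lam_pos n)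
  have h0 := Lam_pos n
  have h5 : 1 + Lam n * δ ≠ 0 := by positivity
  have h6 : 1 + Lam n * δ' ≠ 0 := by positivity
  simp only [Pi.sub_apply, Pi.mul_apply]
  norm_cast
  field_simp
  ring

theorem norm_reg_sub_reg_le {δ δ' : ℝ} (hδ : 0 < δ) (hδ' : 0 < δ') :
    ‖reg δ' - reg δ‖ ≤ |(δ' - δ) / δ| * 2 := by
  rw [reg_sub_reg hδ hδ', norm_smul, Complex.norm_real, Real.norm_eq_abs, abs_neg]
  gcongr
  have h0 : ‖(1 : H2 →L[ℂ] H2)‖ ≤ 1 := ContinuousLinearMap.norm_id_le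
  have h1 : ‖(1 : H2 →L[ℂ] H2) - reg δ‖ ≤ 2 :=
    (norm_sub_le _ _).trans (by linarith [norm_reg_le hδ])
  calc _ ≤ ‖reg δ'‖ * ‖1 - reg δ‖ := norm_mul_le _ _
    _ ≤ 1 * 2 := by
        gcongr
        exact norm_reg_le hδ'
    _ = 2 := by norm_num

theorem tendsto_reg {δ : ℝ} (hδ : 0 < δ) : Tendsto reg (nhds δ) (nhds (reg δ)) := by
  rw [tendsto_iff_norm_sub_tendsto_zero]
  have h1 : Tendsto (fun δ' : ℝ => |(δ' - δ) / δ| * 2) (nhds δ) (nhds 0) := by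
    have : Continuous fun δ' : ℝ => |(δ' - δ) / δ| * 2 := by fun_prop
    simpa using this.tendsto δ
  refine squeeze_zero' (Eventually.of_forall fun _ => norm_nonneg _) ?_ h1
  filter_upwards [lt_mem_nhds hδ] with δ' hδ'
  exact norm_reg_sub_reg_le hδ hδ'

theorem hasDerivAt_reg {δ : ℝ} (hδ : 0 < δ) :
    HasDerivAt reg (-(δ⁻¹ • (reg δ * (1 - reg δ)))) δ := by
  rw [hasDerivAt_iff_tendsto_slope]
  have h1 : Tendsto (fun δ' => -(δ⁻¹ • (reg δ' * (1 - reg δ)))) (nhdsWithin δ {δ}ᶜ)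
      (nhds (-(δ⁻¹ • (reg δ * (1 - reg δ))))) :=
    ((((tendsto_reg hδ).mono_left nhdsWithin_le_nhds).mul_const _).const_smul _).neg
  refine h1.congr' ?_
  filter_upwards [nhdsWithin_le_nhds (lt_mem_nhds hδ), self_mem_nhdsWithin] with δ' hδ' hne
  have hne' : δ' - δ ≠ 0 := sub_ne_zero.2 hne
  have h2 : reg δ' - reg δ = (-((δ' - δ) / δ)) • (reg δ' * (1 - reg δ)) := reg_sub_reg hδ hδ'
  rw [slope_def_module, h2, smul_smul, ← neg_smul]
  congr 1
  field_simp

theorem norm_one_sub_reg_mul_weight_le {s δ : ℝ} (hs : 0 ≤ s) (hs1 : s ≤ 1) (hδ : 0 < δ) :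
    ‖(1 - reg δ) * weight s‖ ≤ δ ^ s := by
  have h1 : BoundedFun ((fun _ => 1) - fun n => (((1 + δ * Lam n)⁻¹ : ℝ) : ℂ)) :=
    BoundedFun.sub ⟨1, fun n => by simp⟩ (boundedFun_reg hδ)
  rw [one_sub_reg hδ, weight, ← mulOp_mul h1 ⟨1, norm_Lam_rpow_neg_le hs⟩]
  refine norm_mulOp_le fun n => ?_
  have h3 := mul_pos hδ (Lam_pos n)
  have h4 := Real.rpow_pos_of_pos (Lam_pos n) s
  simp only [Pi.sub_apply, Pi.mul_apply]
  rw [← Complex.ofReal_one, ← Complex.ofReal_sub, ← Complex.ofReal_mul, Complex.norm_real,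
    Real.norm_of_nonneg (mul_nonneg (sub_nonneg.2 (inv_le_one_of_one_le₀ (by linarith)))
      (Real.rpow_pos_of_pos (Lam_pos n) _).le), Real.rpow_neg (Lam_pos n).le, ← div_eq_mul_inv,
    div_le_iff₀ h4, ← Real.mul_rpow hδ.le (Lam_pos n).le]
  have h5 : 1 - (1 + δ * Lam n)⁻¹ = δ * Lam n / (1 + δ * Lam n) := by
    field_simp
    ring
  rw [h5]
  rcases le_total (δ * Lam n) 1 with h | h
  · refine (div_le_self h3.le (by linarith)).trans ?_
    simpa using Real.rpow_le_rpow_of_exponent_ge h3 h hs1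
  · refine (div_le_one_of_le₀ (by linarith) (by linarith)).trans ?_
    exact Real.one_le_rpow h hs

theorem norm_dil_mul_reg_mul_weight_le {s δ : ℝ} (hs : 0 ≤ s) (hs1 : s ≤ 1) (hδ : 0 < δ)
    (L : ℕ) : ‖dil L * (reg δ * weight s)‖ ≤ 2 * δ ^ (s - 1) := by
  rw [reg, weight, ← mulOp_mul (boundedFun_reg hδ) ⟨1, norm_Lam_rpow_neg_le hs⟩]
  refine norm_dil_mul_mulOp_le L fun n => ?_
  have h0 := Lam_pos n
  have h3 := mul_pos hδ h0
  have h4 := Real.rpow_pos_of_pos h0 (-s)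
  rw [Pi.mul_apply, ← Complex.ofReal_mul, Complex.norm_real, Real.norm_of_nonneg (by positivity)]
  have h5 : δ * Lam n * (1 + δ * Lam n)⁻¹ ≤ (δ * Lam n) ^ s := by
    rw [← div_eq_mul_inv]
    rcases le_total (δ * Lam n) 1 with h | h
    · refine (div_le_self h3.le (by linarith)).trans ?_
      simpa using Real.rpow_le_rpow_of_exponent_ge h3 h hs1
    · refine (div_le_one_of_le₀ (by linarith) (by linarith)).trans ?_
      exact Real.one_le_rpow h hs
  rw [Real.mul_rpow hδ.le h0.le] at h5
  have h6 : Lam n ^ s * Lam n ^ (-s) = 1 := by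
    rw [← Real.rpow_add h0, add_neg_cancel, Real.rpow_zero]
  rw [Real.rpow_sub_one hδ.ne', le_div_iff₀ hδ]
  calc _ = δ * Lam n * (1 + δ * Lam n)⁻¹ * Lam n ^ (-s) := by ring
    _ ≤ δ ^ s * Lam n ^ s * Lam n ^ (-s) := by gcongr
    _ = δ ^ s := by rw [mul_assoc, h6, mul_one]

theorem tendsto_Lam_rpow_neg {s : ℝ} (hs : 0 < s) :
    Tendsto (fun n => ((Lam n ^ (-s) : ℝ) : ℂ)) cofinite (nhds 0) := by
  have h1 : Tendsto Lam cofinite atTop := by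
    have h2 : Tendsto (fun n : ℤ × ℤ => ‖n‖) cofinite atTop := by
      rw [← cocompact_eq_cofinite]
      exact tendsto_norm_cocompact_atTop
    refine tendsto_atTop_mono (fun n => ?_) h2
    have h3 := abs_le_jap n.1
    have h4 := abs_le_jap n.2
    have h5 := half_le_jap n.1
    have h6 := half_le_jap n.2
    rw [Prod.norm_def, Int.norm_eq_abs, Int.norm_eq_abs, Lam]
    exact max_le (by linarith) (by linarith)
  exact_mod_cast ((tendsto_rpow_neg_atTop hs).comp h1).ofReal

end Regularization

section SkewLimits

theorem CommLim.star_eq_neg {X Y : H2 →L[ℂ] H2} (h : CommLim X Y) (hX : IsSelfAdjoint X) :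
    star Y = -Y := by
  refine ContinuousLinearMap.ext fun f => ext_inner_right ℂ fun g => ?_
  rw [ContinuousLinearMap.star_eq_adjoint, ContinuousLinearMap.adjoint_inner_left]
  have h1 : Tendsto (fun L => inner ℂ f ((X * dil L - dil L * X) g)) atTop
      (nhds (inner ℂ f (Y g))) := tendsto_const_nhds.inner (h g)
  have h2 : Tendsto (fun L => inner ℂ (-((X * dil L - dil L * X) f)) g) atTop
      (nhds (inner ℂ (-(Y f)) g)) := ((h f).neg).inner tendsto_const_nhds
  refine tendsto_nhds_unique (h1.congr fun L => ?_) h2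
  rw [← ContinuousLinearMap.adjoint_inner_left, ← ContinuousLinearMap.star_eq_adjoint, star_sub,
    star_mul, star_mul, hX.star_eq, (isSelfAdjoint_dil L).star_eq, ← neg_apply, neg_sub]

end SkewLimits

section Perturbation

/-- The free Laplacian dressed by the multiplication operators `p` and perturbed by the
potential `V`. -/
def dressedLap (p V : ℤ × ℤ → ℝ) : H2 →L[ℂ] H2 :=
  (mulOp fun n => (p n : ℂ)) * freeLap * (mulOp fun n => (p n : ℂ)) + mulOp fun n => (V n : ℂ)

variable {p V : ℤ × ℤ → ℝ}

theorem isSelfAdjoint_dressedLap : IsSelfAdjoint (dressedLap p V) := by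
  refine IsSelfAdjoint.add ?_ (isSelfAdjoint_mulOp_ofReal V)
  have h := isSelfAdjoint_freeLap.conjugate (mulOp fun n => (p n : ℂ))
  rwa [(isSelfAdjoint_mulOp_ofReal p).star_eq] at h

theorem tendsto_ofReal_sub_one (hp : Tendsto p cofinite (nhds 1)) :
    Tendsto (fun n => (p n : ℂ) - 1) cofinite (nhds 0) := by
  have h := (hp.ofReal).sub_const 1
  simpa using h

theorem boundedFun_of_tendsto_one (hp : Tendsto p cofinite (nhds 1)) :
    BoundedFun fun n => (p n : ℂ) := by
  have h1 : BoundedFun fun _ => (-1 : ℂ) := ⟨_, fun _ => le_rfl⟩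
  have h2 := (boundedFun_of_tendsto (tendsto_ofReal_sub_one hp)).sub h1
  convert h2 using 1
  ext n
  simp

theorem mulOp_sub_one (hp : Tendsto p cofinite (nhds 1)) :
    (mulOp fun n => (p n : ℂ)) - 1 = mulOp fun n => (p n : ℂ) - 1 := by
  have h := mulOp_sub (boundedFun_of_tendsto_one hp) (b := fun _ => 1) ⟨1, by simp⟩
  rw [mulOp_const, one_smul] at h
  exact h.symm

theorem negligible_dressedLap_sub {X : H2 →L[ℂ] H2} (hX : IsSelfAdjoint X)
    (hinj : ∀ f, X f = 0 → f = 0) (hp : Tendsto p cofinite (nhds 1))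
    (hV : Tendsto V cofinite (nhds 0)) : Negligible X (dressedLap p V - freeLap) := by
  have h1 := tendsto_ofReal_sub_one hp
  have h2 : Tendsto (fun n => (V n : ℂ)) cofinite (nhds 0) := by
    simpa using hV.ofReal
  set P := mulOp fun n => (p n : ℂ) with hP
  have h3 := ((negligible_mulOp_mul hX hinj h1 (freeLap * P)).add
    ((negligible_mulOp_mul hX hinj h1 1).mul_left freeLap)).add (negligible_mulOp_mul hX hinj h2 1)
  convert h3 using 1
  rw [← mulOp_sub_one hp, dressedLap]
  noncomm_ring

theorem exists_tendsto_weighted_resolvent {s : ℝ} (hs : 1 / 2 < s) (hs1 : s ≤ 1)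
    (hp : Tendsto p cofinite (nhds 1)) (hpd : ∃ C : ℝ, ∀ n, Lam n ^ s * |p n - 1| ≤ C)
    (hpg : GradDecay s p) (hV : Tendsto V cofinite (nhds 0)) (hVg : GradDecay s V) {lam₀ : ℝ}
    (h1 : lam₀ ≠ 1) (h2 : lam₀ ≠ -(1 / 3)) (h3 : lam₀ ≠ -(1 / 2))
    (heig : ∀ f, dressedLap p V f = (lam₀ : ℂ) • f → f = 0) :
    ∃ y : H2 →L[ℂ] H2, Tendsto
      (fun z : ℂ => weight s * Ring.inverse (dressedLap p V - z • 1) * weight s)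
      (nhdsWithin (lam₀ : ℂ) {z | 0 < z.im}) (nhds y) := by
  have hs0 : 0 ≤ s := by linarith
  have hVb : BoundedFun fun n => (V n : ℂ) :=
    boundedFun_of_tendsto (by simpa using hV.ofReal)
  have hPcomm := hpg.commLim hs0 (boundedFun_of_tendsto_one hp)
  have hHcomm : CommLim (dressedLap p V) _ :=
    ((hPcomm.mul commLim_freeLap).mul hPcomm).add (hVg.commLim hs0 hVb)
  obtain ⟨CH, hCH⟩ := hHcomm.exists_norm_le
  obtain ⟨YB, hYB⟩ := exists_commLim_freeComm
  obtain ⟨CB, hCB⟩ := hYB.exists_norm_le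
  obtain ⟨Cd, hCd⟩ := hpd
  have hP1 : weight s ∣ (mulOp fun n => (p n : ℂ)) - 1 := by
    rw [mulOp_sub_one hp]
    refine weight_dvd_mulOp hs0 (C := Cd) fun n => ?_
    rw [← Complex.ofReal_one, ← Complex.ofReal_sub, Complex.norm_real]
    exact hCd n
  obtain ⟨T₁, hT₁⟩ := weight_dvd_commutator (hpg.weight_dvd_gradOp hs0)
    (hVg.weight_dvd_gradOp hs0) hP1 (weight_dvd_mulOp_mul_weight _)
    (weight_dvd_freeLap_mul_weight hs0) (weight_dvd_freeComm_mul_weight hs0)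
  have hYstar := hHcomm.star_eq_neg isSelfAdjoint_dressedLap
  set Y := (gradOp p * freeLap + (mulOp fun n => (p n : ℂ)) * -(Complex.I • freeComm)) *
    (mulOp fun n => (p n : ℂ)) + (mulOp fun n => (p n : ℂ)) * freeLap * gradOp p + gradOp V with hY
  set T := Complex.I • Y - freeComm with hT
  have hTsa : IsSelfAdjoint T := by
    refine IsSelfAdjoint.sub ?_ isSelfAdjoint_freeComm
    rw [isSelfAdjoint_iff, star_smul, hYstar]
    simp
  set X := dressedLap p V - (lam₀ : ℂ) • 1 with hX
  have hXsa : IsSelfAdjoint X := by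
    refine isSelfAdjoint_dressedLap.sub ?_
    rw [isSelfAdjoint_iff, star_smul]
    simp
  have hinj : ∀ f, X f = 0 → f = 0 := fun f hf => heig f (by
    rwa [hX, sub_apply, smul_apply, one_apply_eq_self, sub_eq_zero] at hf)
  have hTneg : Negligible X T := by
    rw [hT₁]
    exact negligible_mulOp_mul hXsa hinj (tendsto_Lam_rpow_neg (by linarith)) T₁
  obtain ⟨c₁, hc₁, hfree⟩ := exists_freeComm_positivity h1 h2 h3
  obtain ⟨c, C₀, ρ, hc, hC₀, hρ, hρ1, hpos⟩ := exists_positivity_of_negligible hc₁ hfree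
    (negligible_dressedLap_sub hXsa hinj hp hV) hTneg
  set κ := 2 + C₀ + ‖X‖ + ‖T₁‖ + ‖freeComm‖ + |CH| + |CB| with hκ
  have n1 := norm_nonneg X
  have n2 := norm_nonneg T₁
  have n3 := norm_nonneg freeComm
  have n4 := abs_nonneg CH
  have n5 := abs_nonneg CB
  let D : ConjugateData H2 :=
    { H := dressedLap p V
      B₀ := freeComm
      T := T
      T₁ := T₁
      W := weight s
      N := reg
      A := dil
      lam₀ := lam₀
      ε := s
      κ := κ
      C₀ := C₀
      c := c
      ρ := ρ
      half_lt_ε := hs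
      ε_le_one := hs1
      one_le_κ := by linarith
      C₀_nonneg := hC₀
      C₀_le := by linarith
      c_pos := hc
      ρ_pos := hρ
      selfAdjoint_H := isSelfAdjoint_dressedLap
      selfAdjoint_T := hTsa
      selfAdjoint_W := isSelfAdjoint_mulOp_ofReal _
      selfAdjoint_N := fun δ => isSelfAdjoint_mulOp_ofReal _
      selfAdjoint_A := isSelfAdjoint_dil
      T_eq := hT₁
      norm_H_sub_le := fun lam hlam => by
        have e1 : dressedLap p V - (lam : ℂ) • 1 = X - ((lam - lam₀ : ℝ) : ℂ) • 1 := by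
          rw [hX, Complex.ofReal_sub, sub_smul]
          abel
        have e2 : ‖((lam - lam₀ : ℝ) : ℂ) • (1 : H2 →L[ℂ] H2)‖ ≤ 1 := by
          rw [norm_smul, Complex.norm_real, Real.norm_eq_abs]
          have e3 : ‖(1 : H2 →L[ℂ] H2)‖ ≤ 1 := ContinuousLinearMap.norm_id_le
          exact mul_le_one₀ (hlam.le.trans hρ1) (norm_nonneg _) e3
        rw [e1]
        exact (norm_sub_le _ _).trans (by linarith)
      norm_W_le := (norm_mulOp_le (norm_Lam_rpow_neg_le hs0)).trans (by linarith)
      norm_T₁_le := by linarith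
      norm_B₀_le := by linarith
      norm_N_le := fun δ => norm_reg_le
      commute_N_W := fun δ => commute_mulOp _ _
      hasDerivAt_N := fun δ => hasDerivAt_reg
      norm_one_sub_N_mul_W_le := fun δ hδ =>
        (norm_one_sub_reg_mul_weight_le hs0 hs1 hδ).trans
          (le_mul_of_one_le_left (Real.rpow_pos_of_pos hδ _).le (by linarith))
      norm_A_mul_N_mul_W_le := fun L δ hδ =>
        (norm_dil_mul_reg_mul_weight_le hs0 hs1 hδ L).trans
          (mul_le_mul_of_nonneg_right (by linarith) (Real.rpow_pos_of_pos hδ _).le)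
      norm_commutator_H_le := fun L => (hCH L).trans (by linarith [le_abs_self CH])
      norm_commutator_B₀_le := fun L => (hCB L).trans (by linarith [le_abs_self CB])
      tendsto_commutator := fun f g => by
        have e1 : -(Complex.I • (freeComm + T) g) = Y g := by
          rw [hT, add_sub_cancel, smul_apply, smul_smul, Complex.I_mul_I, neg_smul, one_smul,
            neg_neg]
        rw [e1]
        exact tendsto_const_nhds.inner (hHcomm g)
      positivity := hpos }
  exact D.exists_tendsto_weightedResolvent

theorem abs_inv_sqrt_sub_inv_sqrt_le {c x y : ℝ} (hc : 0 < c) (hx : c ≤ x) (hy : c ≤ y) :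
    |(√x)⁻¹ - (√y)⁻¹| ≤ (c * √c)⁻¹ * |x - y| := by
  have h0 := Real.sqrt_pos.2 hc
  have h1 : √c ≤ √x := Real.sqrt_le_sqrt hx
  have h2 : √c ≤ √y := Real.sqrt_le_sqrt hy
  have h3 : √c ^ 2 = c := Real.sq_sqrt hc.le
  have h4 : √x ^ 2 = x := Real.sq_sqrt (hc.le.trans hx)
  have h5 : √y ^ 2 = y := Real.sq_sqrt (hc.le.trans hy)
  have h6 := h0.trans_le h1
  have h7 := h0.trans_le h2
  have e1 : (√x)⁻¹ - (√y)⁻¹ = (√x * √y * (√x + √y))⁻¹ * (y - x) := by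
    rw [← h4, ← h5, Real.sqrt_sq h6.le, Real.sqrt_sq h7.le]
    field_simp
    ring
  rw [e1, abs_mul, abs_of_pos (by positivity), abs_sub_comm y x]
  refine mul_le_mul_of_nonneg_right (inv_anti₀ (by positivity) ?_) (abs_nonneg _)
  calc c * √c = √c * √c * √c := by rw [← pow_two, h3]
    _ ≤ √x * √y * (√x + √y) := by
        gcongr
        linarith

theorem eq_dressedLap {η V : ℤ × ℤ → ℝ} {Ht : H2 →L[ℂ] H2}
    (hp : BoundedFun fun n => (((√(1 + η n))⁻¹ : ℝ) : ℂ)) (hV : BoundedFun fun n => (V n : ℂ))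
    (hHt : ∀ (f : H2) (n : ℤ × ℤ),
      Ht f n = lapPert (fun k => 1 + η k) (⇑f) n + (V n : ℂ) * f n) :
    Ht = dressedLap (fun n => (√(1 + η n))⁻¹) V := by
  refine ContinuousLinearMap.ext fun f => lp.ext (funext fun n => ?_)
  rw [hHt, dressedLap, add_apply, lp.coeFn_add, Pi.add_apply, mulOp_apply hV]
  congr 1
  rw [mul_apply_eq_comp, mul_apply_eq_comp, mulOp_apply hp, freeLap, smul_apply, lp.coeFn_smul,
    Pi.smul_apply, sum_nbrs]
  simp only [add_apply, lp.coeFn_add, Pi.add_apply, shift_apply, mulOp_apply hp, lapPert,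
    Prod.add_def, add_zero, ← sub_eq_add_neg, smul_eq_mul]
  push_cast
  ring

end Perturbation

/-- the boundary values of the weighted resolvent of `H̃` exist in operator
norm and depend continuously on the spectral parameter. -/
theorem boundary_values_weighted_resolvent
    (ε : ℝ) (hε : 1/2 < ε) (η : ℤ × ℤ → ℝ)
    (h0inf : ∃ c : ℝ, -1 < c ∧ ∀ n : ℤ × ℤ, c ≤ η n)
    (h0lim : Filter.Tendsto η Filter.cofinite (nhds 0))
    (h1 : ∃ C : ℝ, ∀ n : ℤ × ℤ,
      Lam n ^ ε * jap (n.1 : ℝ) * |η n - η (n.1 + 1, n.2)| ≤ C)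
    (h2 : ∃ C : ℝ, ∀ n : ℤ × ℤ,
      Lam n ^ ε * jap (n.2 : ℝ) * |η n - η (n.1, n.2 + 1)| ≤ C)
    (h3 : ∃ C : ℝ, ∀ n : ℤ × ℤ,
      Lam n ^ ε * jap ((n.1 : ℝ) - (n.2 : ℝ)) * |η n - η (n.1 + 1, n.2 - 1)| ≤ C)
    (h4 : ∃ C : ℝ, ∀ n : ℤ × ℤ, Lam n ^ ε * |η n| ≤ C)
    (V : ℤ × ℤ → ℝ)
    (hV0 : Filter.Tendsto V Filter.cofinite (nhds 0))
    (hV1 : ∃ C : ℝ, ∀ n : ℤ × ℤ,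
      Lam n ^ ε * jap (n.1 : ℝ) * |V n - V (n.1 + 1, n.2)| ≤ C)
    (hV2 : ∃ C : ℝ, ∀ n : ℤ × ℤ,
      Lam n ^ ε * jap (n.2 : ℝ) * |V n - V (n.1, n.2 + 1)| ≤ C)
    (hV3 : ∃ C : ℝ, ∀ n : ℤ × ℤ,
      Lam n ^ ε * jap ((n.1 : ℝ) - (n.2 : ℝ)) * |V n - V (n.1 + 1, n.2 - 1)| ≤ C)
    (Ht : H2 →L[ℂ] H2)
    (hHt : ∀ (f : H2) (n : ℤ × ℤ),
      Ht f n = lapPert (fun k => 1 + η k) (⇑f) n + (V n : ℂ) * f n)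
    (W : H2 →L[ℂ] H2)
    (hW : ∀ (f : H2) (n : ℤ × ℤ), W f n = ((Lam n ^ (-ε) : ℝ) : ℂ) * f n)
    (a b : ℝ) (hab : a ≤ b)
    (hthr : Set.Icc a b ∩ ({-(1/2), -(1/3), 1} : Set ℝ) = ∅)
    (heig : ∀ lam ∈ Set.Icc a b, ∀ f : H2, Ht f = (lam : ℂ) • f → f = 0) :
    ∃ r : ℝ → (H2 →L[ℂ] H2), ContinuousOn r (Set.Icc a b) ∧
      ∀ lam ∈ Set.Icc a b,
        Filter.Tendsto
          (fun ρ : ℝ => W ∘L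
            Ring.inverse (Ht - algebraMap ℂ (H2 →L[ℂ] H2) ((lam : ℂ) + (ρ : ℂ) * Complex.I)) ∘L W)
          (nhdsWithin 0 (Set.Ioi 0)) (nhds (r lam)) := by
  set s := min ε 1 with hs
  have hs1 : s ≤ 1 := min_le_right _ _
  have hsε : s ≤ ε := min_le_left _ _
  have hs2 : 1 / 2 < s := lt_min hε (by norm_num)
  have hs0 : 0 ≤ s := by linarith
  obtain ⟨c, hc, hηc⟩ := h0inf
  set c₀ := min (1 + c) 1 with hc₀
  have hc₀pos : 0 < c₀ := lt_min (by linarith) one_pos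
  have hηc₀ : ∀ n, c₀ ≤ 1 + η n := fun n => (min_le_left _ _).trans (by linarith [hηc n])
  set p : ℤ × ℤ → ℝ := fun n => (√(1 + η n))⁻¹ with hp
  set K := (c₀ * √c₀)⁻¹ with hK
  have hK0 : 0 ≤ K := by positivity
  have hpp : ∀ n l, |p n - p l| ≤ K * |η n - η l| := fun n l => by
    have k := abs_inv_sqrt_sub_inv_sqrt_le hc₀pos (hηc₀ n) (hηc₀ l)
    rwa [add_sub_add_left_eq_sub] at k
  have hp1 : ∀ n, |p n - 1| ≤ K * |η n| := fun n => by
    have k := abs_inv_sqrt_sub_inv_sqrt_le hc₀pos (hηc₀ n) (min_le_right _ _)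
    rwa [Real.sqrt_one, inv_one, add_sub_cancel_left] at k
  have hplim : Filter.Tendsto p Filter.cofinite (nhds 1) := by
    rw [tendsto_iff_norm_sub_tendsto_zero]
    exact squeeze_zero (fun n => norm_nonneg _) hp1 (by simpa using h0lim.abs.const_mul K)
  have hpd : ∃ C : ℝ, ∀ n, Lam n ^ s * |p n - 1| ≤ C := by
    obtain ⟨C, hC⟩ := h4
    refine ⟨K * C, fun n => ?_⟩
    have k1 : Lam n ^ s ≤ Lam n ^ ε := Real.rpow_le_rpow_of_exponent_le (one_le_Lam n) hsε
    calc Lam n ^ s * |p n - 1| ≤ Lam n ^ ε * (K * |η n|) :=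
          mul_le_mul k1 (hp1 n) (abs_nonneg _) (Real.rpow_pos_of_pos (Lam_pos n) _).le
      _ = K * (Lam n ^ ε * |η n|) := by ring
      _ ≤ K * C := mul_le_mul_of_nonneg_left (hC n) hK0
  have hpg : GradDecay s p := (gradDecay_of_forall_le hs0 hsε h1 h2 h3).of_abs_sub_le hK0 hpp
  have hVg : GradDecay s V := gradDecay_of_forall_le hs0 hsε hV1 hV2 hV3
  have hHt' : Ht = dressedLap p V := eq_dressedLap (boundedFun_of_tendsto_one hplim)
    (boundedFun_of_tendsto (by simpa using hV0.ofReal)) hHt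
  obtain ⟨Z, hWZ, hZW⟩ : ∃ Z, W = Z * weight s ∧ W = weight s * Z := by
    have k1 : W = weight ε := by
      refine ContinuousLinearMap.ext fun f => lp.ext (funext fun n => ?_)
      rw [hW, weight, mulOp_apply ⟨1, norm_Lam_rpow_neg_le (by linarith)⟩]
    have k2 : weight ε = weight (ε - s) * weight s := by
      rw [weight, weight, weight, ← mulOp_mul ⟨1, norm_Lam_rpow_neg_le (by linarith)⟩
        ⟨1, norm_Lam_rpow_neg_le hs0⟩]
      congr 1
      ext n
      rw [Pi.mul_apply, ← Complex.ofReal_mul, ← Real.rpow_add (Lam_pos n)]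
      congr 2
      ring
    exact ⟨weight (ε - s), k1.trans k2, (k1.trans k2).trans (commute_mulOp _ _)⟩
  set R : ℂ → H2 →L[ℂ] H2 := fun z => W * Ring.inverse (Ht - z • 1) * W with hR
  have hlim : ∀ lam ∈ Set.Icc a b, ∃ y,
      Filter.Tendsto R (nhdsWithin (lam : ℂ) {z | 0 < z.im}) (nhds y) := by
    intro lam hlam
    have k1 : ∀ t : ℝ, t ∈ ({-(1/2), -(1/3), 1} : Set ℝ) → lam ≠ t := by
      rintro t ht rfl
      exact (Set.eq_empty_iff_forall_notMem.1 hthr lam) ⟨hlam, ht⟩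
    obtain ⟨y, hy⟩ := exists_tendsto_weighted_resolvent hs2 hs1 hplim hpd hpg hV0 hVg
      (k1 1 (by simp)) (k1 (-(1 / 3)) (by simp)) (k1 (-(1 / 2)) (by simp))
      (hHt' ▸ heig lam hlam)
    refine ⟨Z * y * Z, ((hy.const_mul Z).mul_const Z).congr fun z => ?_⟩
    rw [hR, ← hHt']
    simp only
    nth_rewrite 1 [hWZ]
    nth_rewrite 1 [hZW]
    simp only [mul_assoc]
  set U : Set ℂ := {z | 0 < z.im} with hU
  have hmem : ∀ lam : ℝ, (lam : ℂ) ∈ closure U := fun lam => by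
    rw [hU, Complex.closure_setOfPred_lt_im]
    simp
  set B : Set ℂ := (fun lam : ℝ => (lam : ℂ)) '' Set.Icc a b with hB
  have hcont : ContinuousOn (extendFrom U R) B := by
    refine continuousOn_extendFrom ?_ ?_
    · rintro _ ⟨lam, -, rfl⟩
      exact hmem lam
    · rintro _ ⟨lam, hlam, rfl⟩
      exact hlim lam hlam
  refine ⟨fun lam => extendFrom U R lam, hcont.comp Complex.continuous_ofReal.continuousOn
    (Set.mapsTo_image _ _), fun lam hlam => ?_⟩
  have hpath : Filter.Tendsto (fun ρ : ℝ => (lam : ℂ) + (ρ : ℂ) * Complex.I)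
      (nhdsWithin 0 (Set.Ioi 0)) (nhdsWithin (lam : ℂ) U) := by
    refine tendsto_nhdsWithin_iff.2 ⟨?_, ?_⟩
    · have k1 : Continuous fun ρ : ℝ => (lam : ℂ) + (ρ : ℂ) * Complex.I := by fun_prop
      have k2 := (k1.tendsto 0).mono_left (nhdsWithin_le_nhds (s := Set.Ioi 0))
      simpa using k2
    · filter_upwards [self_mem_nhdsWithin] with ρ hρ
      simpa [hU] using hρ
  refine ((tendsto_extendFrom (hlim lam hlam)).comp hpath).congr fun ρ => ?_
  rw [Algebra.algebraMap_eq_smul_one]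
  rfl
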